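/- arXiv:1308.3310 — 12 statements merged into one kernel-verified Lean document; each statement's English description precedes it below -/
import Mathlib

section
/- Let K₁ and K₂ be M×M Hermitian positive semidefinite complex matrices with K₁ ⪯ K₂, and let S be an arbitrary M×N complex matrix. For a Hermitian positive semidefinite M×M matrix K define L(K,S) := K − K S (I_N + S† K S)⁻¹ S† K (the matrix I_N + S† K S is positive definite, hence invertible). Then L(K₁,S) ⪯ L(K₂,S). -/
open Matrix
open scoped ComplexOrder

/-- Completing the square: the quadratic `G ↦ (1 - S G)ᴴ K (1 - S G) + Gᴴ G` is minimized at
`G = (1 + Sᴴ K S)⁻¹ Sᴴ K`, with minimum `L(K, S)`. -/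
lemma complete_square_aux {M N : ℕ} (K : Matrix (Fin M) (Fin M) ℂ) (S : Matrix (Fin M) (Fin N) ℂ)
    (A B : Matrix (Fin N) (Fin N) ℂ) (hK : Kᴴ = K) (hA : A = 1 + Sᴴ * K * S) (hB : Bᴴ = B)
    (hAB : A * B = 1) (hBA : B * A = 1) (G : Matrix (Fin N) (Fin M) ℂ) :
    (1 - S * G)ᴴ * K * (1 - S * G) + Gᴴ * G =
      (K - K * S * B * Sᴴ * K) + (G - B * Sᴴ * K)ᴴ * A * (G - B * Sᴴ * K) := by
  have e1 : (1 - S * G)ᴴ * K * (1 - S * G) + Gᴴ * G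
      = K - K * S * G - Gᴴ * (Sᴴ * K) + Gᴴ * A * G := by
    rw [hA]
    simp only [conjTranspose_sub, conjTranspose_mul, conjTranspose_one, Matrix.mul_sub,
      Matrix.sub_mul, Matrix.mul_add, Matrix.add_mul, Matrix.mul_one, Matrix.one_mul,
      Matrix.mul_assoc]
    abel
  have h1 : ∀ X : Matrix (Fin N) (Fin M) ℂ, A * (B * X) = X := fun X => by
    rw [← Matrix.mul_assoc, hAB, Matrix.one_mul]
  have h2 : ∀ X : Matrix (Fin N) (Fin M) ℂ, B * (A * X) = X := fun X => by
    rw [← Matrix.mul_assoc, hBA, Matrix.one_mul]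
  rw [e1]
  simp only [conjTranspose_sub, conjTranspose_mul, conjTranspose_conjTranspose, hK, hB,
    Matrix.mul_sub, Matrix.sub_mul, Matrix.mul_assoc, h1, h2]
  abel

lemma posDef_aux {M N : ℕ} (K : Matrix (Fin M) (Fin M) ℂ) (S : Matrix (Fin M) (Fin N) ℂ)
    (hK : K.PosSemidef) : (1 + Sᴴ * K * S).PosDef :=
  Matrix.PosDef.one.add_posSemidef (hK.conjTranspose_mul_mul_same S)

/-- For Hermitian positive semidefinite `M × M` complex matrices
`K₁ ⪯ K₂` and an arbitrary `M × N` complex matrix `S`, with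
`L(K, S) = K - K S (I_N + Sᴴ K S)⁻¹ Sᴴ K`, we have `L(K₁, S) ⪯ L(K₂, S)`. -/
theorem loewner_monotone_of_psd
    {M N : ℕ} (K₁ K₂ : Matrix (Fin M) (Fin M) ℂ) (S : Matrix (Fin M) (Fin N) ℂ)
    (hK₁ : K₁.PosSemidef) (hK₂ : K₂.PosSemidef) (h₁₂ : (K₂ - K₁).PosSemidef) :
    ((K₂ - K₂ * S * (1 + Sᴴ * K₂ * S)⁻¹ * Sᴴ * K₂) -
      (K₁ - K₁ * S * (1 + Sᴴ * K₁ * S)⁻¹ * Sᴴ * K₁)).PosSemidef := by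
  have p1 := posDef_aux K₁ S hK₁
  have p2 := posDef_aux K₂ S hK₂
  have u1 := (Matrix.isUnit_iff_isUnit_det _).1 p1.isUnit
  have u2 := (Matrix.isUnit_iff_isUnit_det _).1 p2.isUnit
  have c1 := complete_square_aux K₁ S _ _ hK₁.1 rfl p1.inv.1 (Matrix.mul_nonsing_inv _ u1)
    (Matrix.nonsing_inv_mul _ u1) ((1 + Sᴴ * K₂ * S)⁻¹ * Sᴴ * K₂)
  have c2 := complete_square_aux K₂ S _ _ hK₂.1 rfl p2.inv.1 (Matrix.mul_nonsing_inv _ u2)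
    (Matrix.nonsing_inv_mul _ u2) ((1 + Sᴴ * K₂ * S)⁻¹ * Sᴴ * K₂)
  rw [sub_self, Matrix.mul_zero, add_zero] at c2
  have q1 := p1.posSemidef.conjTranspose_mul_mul_same
    ((1 + Sᴴ * K₂ * S)⁻¹ * Sᴴ * K₂ - (1 + Sᴴ * K₁ * S)⁻¹ * Sᴴ * K₁)
  have q2 := h₁₂.conjTranspose_mul_mul_same (1 - S * ((1 + Sᴴ * K₂ * S)⁻¹ * Sᴴ * K₂))
  have q := q2.add q1
  rw [Matrix.mul_sub _ K₂ K₁, Matrix.sub_mul (_ * K₂) (_ * K₁)] at q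
  rw [← c2, eq_sub_of_add_eq c1.symm]
  convert q using 1
  abel
end

section
/- Let Q be an M×M Hermitian positive semidefinite complex matrix, let H₂ be an N₂×M complex matrix, H₁ an N₁×M complex matrix, and ρ₁, ρ₂ ≥ 0 real numbers. Define Δ := I_{N₂} + ρ₂ H₂ Q H₂†. Then log₂ det( I_{N₂} + Δ + ρ₂ H₂ ( Q − ρ₁ Q H₁† (I_{N₁} + ρ₁ H₁ Q H₁†)⁻¹ H₁ Q ) H₂† ) − log₂ det Δ ≤ N₂ (both determinants are positive real numbers, since the matrices involved are Hermitian positive definite). This is the bound ξ ≤ N₂ on the rate loss incurred by quantizing the received signal at distortion Δ. -/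
open Matrix
open scoped ComplexOrder

lemma aux_one_le_det {n : ℕ} (R : Matrix (Fin n) (Fin n) ℂ) (hR : R.PosSemidef) :
    ∃ r : ℝ, 1 ≤ r ∧ (1 + R).det = (r : ℂ) := by
  have hA : (1 + R).IsHermitian := isHermitian_one.add hR.1
  refine ⟨∏ i, hA.eigenvalues i, ?_, ?_⟩
  · have h1 : ∀ i, 1 ≤ hA.eigenvalues i := by
      intro i
      have hn : star (⇑(hA.eigenvectorBasis i)) ⬝ᵥ ⇑(hA.eigenvectorBasis i) = (1 : ℂ) := by
        rw [dotProduct_comm, ← EuclideanSpace.inner_eq_star_dotProduct]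
        simp
      have h2 := (posSemidef_iff_dotProduct_mulVec.1 hR).2 (⇑(hA.eigenvectorBasis i))
      have h3 := (Complex.nonneg_iff.1 h2).1
      rw [hA.eigenvalues_eq, add_mulVec, one_mulVec, dotProduct_add, hn]
      simpa using h3
    calc (1 : ℝ) = ∏ i : Fin n, (1 : ℝ) := by simp
      _ ≤ _ := Finset.prod_le_prod (fun _ _ => zero_le_one) (fun i _ => h1 i)
  · rw [hA.det_eq_prod_eigenvalues]; simp

open scoped MatrixOrder Matrix.Norms.L2Operator in
lemma aux_det_mono {n : ℕ} (X P : Matrix (Fin n) (Fin n) ℂ) (hX : X.PosDef)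
    (hP : P.PosSemidef) : 0 < X.det.re ∧ X.det.re ≤ (X + P).det.re := by
  have h0 := Complex.pos_iff.1 hX.det_pos
  refine ⟨h0.1, ?_⟩
  obtain ⟨B, rfl⟩ := CStarAlgebra.nonneg_iff_eq_star_mul_self.1 hP.nonneg
  rw [star_eq_conjTranspose]
  obtain ⟨r, hr, h⟩ := aux_one_le_det (B * X⁻¹ * Bᴴ)
    (hX.inv.posSemidef.mul_mul_conjTranspose_same B)
  rw [det_add_mul _ _ hX.det_pos.ne'.isUnit, h, Complex.re_mul_ofReal]
  nlinarith [h0.1]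

theorem quantization_rate_loss_le
    {M N₁ N₂ : ℕ} (Q : Matrix (Fin M) (Fin M) ℂ) (hQ : Q.PosSemidef)
    (H₂ : Matrix (Fin N₂) (Fin M) ℂ) (H₁ : Matrix (Fin N₁) (Fin M) ℂ)
    (ρ₁ ρ₂ : ℝ) (hρ₁ : 0 ≤ ρ₁) (hρ₂ : 0 ≤ ρ₂) :
    Real.logb 2
        ((1 + (1 + (ρ₂ : ℂ) • (H₂ * Q * H₂ᴴ)) +
            (ρ₂ : ℂ) • (H₂ *
              (Q - (ρ₁ : ℂ) • (Q * H₁ᴴ * (1 + (ρ₁ : ℂ) • (H₁ * Q * H₁ᴴ))⁻¹ * H₁ * Q)) *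
              H₂ᴴ)).det.re) -
      Real.logb 2 ((1 + (ρ₂ : ℂ) • (H₂ * Q * H₂ᴴ)).det.re) ≤ (N₂ : ℝ) := by
  have h1 : (0 : ℂ) ≤ (ρ₁ : ℂ) := by exact_mod_cast hρ₁
  have h2 : (0 : ℂ) ≤ (ρ₂ : ℂ) := by exact_mod_cast hρ₂
  have hS : (1 + (ρ₁ : ℂ) • (H₁ * Q * H₁ᴴ)).PosDef :=
    PosDef.one.add_posSemidef ((hQ.mul_mul_conjTranspose_same H₁).smul h1)
  have hΔ : (1 + (ρ₂ : ℂ) • (H₂ * Q * H₂ᴴ)).PosDef :=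
    PosDef.one.add_posSemidef ((hQ.mul_mul_conjTranspose_same H₂).smul h2)
  have hT : ((ρ₁ : ℂ) • (Q * H₁ᴴ * (1 + (ρ₁ : ℂ) • (H₁ * Q * H₁ᴴ))⁻¹ * H₁ * Q)).PosSemidef := by
    have := (hS.inv.posSemidef.mul_mul_conjTranspose_same (Q * H₁ᴴ)).smul h1
    simpa [conjTranspose_mul, hQ.1.eq, Matrix.mul_assoc] using this
  have hC : (Q - (ρ₁ : ℂ) • (Q * H₁ᴴ * (1 + (ρ₁ : ℂ) • (H₁ * Q * H₁ᴴ))⁻¹ * H₁ * Q)).PosSemidef := by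
    set s : ℂ := (Real.sqrt ρ₁ : ℂ) with hs
    have hss : s * s = ρ₁ := by rw [hs]; exact_mod_cast Real.mul_self_sqrt hρ₁
    have hst : star s = s := by simp [hs]
    have hB : (fromBlocks (1 + (ρ₁ : ℂ) • (H₁ * Q * H₁ᴴ)) (s • (H₁ * Q))
        (s • (H₁ * Q))ᴴ Q).PosSemidef := by
      have e1 := hQ.mul_mul_conjTranspose_same (fromRows (s • H₁) (1 : Matrix (Fin M) (Fin M) ℂ))
      have e2 := (PosSemidef.one (R := ℂ) (n := Fin N₁)).mul_mul_conjTranspose_same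
        (fromRows (1 : Matrix (Fin N₁) (Fin N₁) ℂ) (0 : Matrix (Fin M) (Fin N₁) ℂ))
      convert e2.add e1 using 1
      simp [conjTranspose_fromRows_eq_fromCols_conjTranspose, fromRows_mul, hQ.1.eq, hst]
      ext (i | i) (j | j) <;> simp [← mul_assoc, hss]
    have := hS.isUnit.invertible
    have := (PosDef.fromBlocks₁₁ (s • (H₁ * Q)) Q hS).1 hB
    simpa [conjTranspose_mul, hQ.1.eq, hs, Matrix.mul_assoc, smul_smul, Real.mul_self_sqrt hρ₁] using this
  set T := (ρ₁ : ℂ) • (Q * H₁ᴴ * (1 + (ρ₁ : ℂ) • (H₁ * Q * H₁ᴴ))⁻¹ * H₁ * Q) with hTd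
  have hX := (PosDef.one.add hΔ).add_posSemidef ((hC.mul_mul_conjTranspose_same H₂).smul h2)
  obtain ⟨hp, hle⟩ := aux_det_mono _ _ hX ((hT.mul_mul_conjTranspose_same H₂).smul h2)
  have hD := (Complex.pos_iff.1 hΔ.det_pos).1
  have he : 1 + (1 + (ρ₂ : ℂ) • (H₂ * Q * H₂ᴴ)) + (ρ₂ : ℂ) • (H₂ * (Q - T) * H₂ᴴ)
      + (ρ₂ : ℂ) • (H₂ * T * H₂ᴴ) = (2 : ℂ) • (1 + (ρ₂ : ℂ) • (H₂ * Q * H₂ᴴ)) := by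
    rw [Matrix.mul_sub, Matrix.sub_mul, smul_sub, two_smul]
    abel
  have hr : ((2 : ℂ) ^ N₂ * (1 + (ρ₂ : ℂ) • (H₂ * Q * H₂ᴴ)).det).re
      = 2 ^ N₂ * (1 + (ρ₂ : ℂ) • (H₂ * Q * H₂ᴴ)).det.re := by
    rw [← Complex.re_ofReal_mul]; push_cast; rfl
  rw [he, det_smul, Fintype.card_fin, hr] at hle
  have := Real.logb_le_logb_of_le (b := 2) (by norm_num) hp hle
  rw [Real.logb_mul (by positivity) hD.ne', Real.logb_pow, Real.logb_self_eq_one (by norm_num)] at this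
  linarith
end

section
/- Let A, B, C be M×M Hermitian complex matrices with A positive definite and B, C positive semidefinite. Then det(A+B) · det(A+C) ≥ det(A+B+C) · det(A), where all four determinants are positive real numbers. -/
open Matrix
open scoped ComplexOrder

theorem aux_one_le {M : ℕ} (S : Matrix (Fin M) (Fin M) ℂ) (hS : S.PosSemidef) :
    1 ≤ (1 + S).det := by
  have hH : (1 + S).IsHermitian := Matrix.isHermitian_one.add hS.isHermitian
  rw [hH.det_eq_prod_eigenvalues]
  have key : ∀ i, 1 ≤ hH.eigenvalues i := by
    intro i
    have h1 := hH.mulVec_eigenvectorBasis i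
    set v : Fin M → ℂ := ⇑(hH.eigenvectorBasis i) with hv
    have hv0 : v ≠ 0 := by
      intro h
      apply hH.eigenvectorBasis.orthonormal.ne_zero i
      ext j
      exact congrFun h j
    have h2 := hS.dotProduct_mulVec_nonneg v
    have h3 : S *ᵥ v = ((hH.eigenvalues i - 1 : ℝ) : ℂ) • v := by
      rw [Matrix.add_mulVec, Matrix.one_mulVec] at h1
      have h4 : S *ᵥ v = hH.eigenvalues i • v - v := by rw [← h1]; abel
      rw [h4]
      ext j
      simp [sub_mul]
    rw [h3, dotProduct_smul, smul_eq_mul] at h2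
    have h5 : 0 < star v ⬝ᵥ v := Matrix.dotProduct_star_self_pos_iff.mpr hv0
    have h6 : (0:ℂ) ≤ ((hH.eigenvalues i - 1 : ℝ) : ℂ) :=
      le_of_mul_le_mul_right (by rwa [zero_mul]) h5
    have h7 : (0:ℝ) ≤ hH.eigenvalues i - 1 := by exact_mod_cast h6
    linarith
  have : (1:ℝ) ≤ ∏ i, hH.eigenvalues i := by
    simpa using Finset.prod_le_prod (s := Finset.univ) (f := fun _ : Fin M => (1:ℝ))
      (fun _ _ => zero_le_one) (fun i _ => key i)
  simpa using (by exact_mod_cast this : (1:ℂ) ≤ ((∏ i, hH.eigenvalues i : ℝ) : ℂ))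

theorem aux_factor {M : ℕ} (X L : Matrix (Fin M) (Fin M) ℂ) (hX : X.PosDef) :
    (X + Lᴴ * L).det = X.det * (1 + L * X⁻¹ * Lᴴ).det := by
  have hu : IsUnit X.det := hX.det_pos.ne'.isUnit
  have : X + Lᴴ * L = X * (1 + X⁻¹ * Lᴴ * L) := by
    rw [Matrix.mul_add, Matrix.mul_one, Matrix.mul_assoc, Matrix.mul_nonsing_inv_cancel_left _ _ hu]
  rw [this, det_mul, det_one_add_mul_comm, Matrix.mul_assoc L]

theorem aux_exists {M : ℕ} (C : Matrix (Fin M) (Fin M) ℂ) (hC : C.PosSemidef) :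
    ∃ L : Matrix (Fin M) (Fin M) ℂ, C = Lᴴ * L := by
  open scoped MatrixOrder in
  exact CStarAlgebra.nonneg_iff_eq_star_mul_self.mp hC.nonneg

theorem aux_mono {M : ℕ} (P Q : Matrix (Fin M) (Fin M) ℂ) (hP : P.PosDef) (hQ : Q.PosSemidef) :
    P.det ≤ (P + Q).det := by
  obtain ⟨L, rfl⟩ := aux_exists Q hQ
  rw [aux_factor P L hP]
  exact le_mul_of_one_le_right hP.det_pos.le
    (aux_one_le _ (hP.inv.posSemidef.mul_mul_conjTranspose_same L))

theorem aux_inv {M : ℕ} (A B : Matrix (Fin M) (Fin M) ℂ) (hA : A.PosDef) (hB : B.PosSemidef) :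
    (A⁻¹ - (A + B)⁻¹).PosSemidef := by
  have hAB := hA.add_posSemidef hB
  have hu : IsUnit A.det := hA.det_pos.ne'.isUnit
  have hw : IsUnit (A + B).det := hAB.det_pos.ne'.isUnit
  have h : A⁻¹ - (A + B)⁻¹ = (A + B)⁻¹ * (B + B * A⁻¹ * B) * (A + B)⁻¹ᴴ := by
    rw [hAB.inv.isHermitian.eq]
    have e : B + B * A⁻¹ * B = (A + B) * (A⁻¹ - (A + B)⁻¹) * (A + B) := by
      rw [Matrix.mul_sub, Matrix.mul_nonsing_inv _ hw, Matrix.add_mul,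
        Matrix.mul_nonsing_inv _ hu, add_sub_cancel_left, Matrix.mul_add,
        Matrix.nonsing_inv_mul_cancel_right _ _ hu]
    rw [e, Matrix.mul_assoc, Matrix.mul_nonsing_inv_cancel_right _ _ hw,
      Matrix.nonsing_inv_mul_cancel_left _ _ hw]
  rw [h]
  refine Matrix.PosSemidef.mul_mul_conjTranspose_same (hB.add ?_) _
  have := hA.inv.posSemidef.mul_mul_conjTranspose_same B
  rwa [hB.isHermitian.eq] at this

/-- For `M × M` Hermitian complex matrices with `A` positive
definite and `B`, `C` positive semidefinite,
`det(A+B) · det(A+C) ≥ det(A+B+C) · det(A)` (all determinants being positive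
reals; we compare their real parts). -/
theorem det_add_mul_det_add_ge
    {M : ℕ} (A B C : Matrix (Fin M) (Fin M) ℂ)
    (hA : A.PosDef) (hB : B.PosSemidef) (hC : C.PosSemidef) :
    (A + B + C).det.re * A.det.re ≤ (A + B).det.re * (A + C).det.re := by
  have hAB := hA.add_posSemidef hB
  have hABC := hAB.add_posSemidef hC
  have hAC := hA.add_posSemidef hC
  have key : (A + B + C).det * A.det ≤ (A + B).det * (A + C).det := by
    obtain ⟨L, rfl⟩ := aux_exists C hC
    rw [aux_factor _ L hA, aux_factor _ L hAB]
    have hm : (1 + L * (A + B)⁻¹ * Lᴴ).det ≤ (1 + L * A⁻¹ * Lᴴ).det := by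
      have h := aux_mono (1 + L * (A + B)⁻¹ * Lᴴ) (L * (A⁻¹ - (A + B)⁻¹) * Lᴴ)
        (Matrix.PosDef.one.add_posSemidef (hAB.inv.posSemidef.mul_mul_conjTranspose_same L))
        ((aux_inv A B hA hB).mul_mul_conjTranspose_same L)
      have e : 1 + L * (A + B)⁻¹ * Lᴴ + L * (A⁻¹ - (A + B)⁻¹) * Lᴴ = 1 + L * A⁻¹ * Lᴴ := by
        rw [Matrix.mul_sub, Matrix.sub_mul]; abel
      rwa [e] at h
    have := mul_le_mul_of_nonneg_left hm (mul_nonneg hAB.det_pos.le hA.det_pos.le)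
    calc _ = _ := by ring
      _ ≤ _ := this
      _ = _ := by ring
  have h := (Complex.le_def.mp key).1
  have i1 := (Complex.lt_def.mp hA.det_pos).2
  have i2 := (Complex.lt_def.mp hAB.det_pos).2
  rw [Complex.mul_re, Complex.mul_re, ← i1, ← i2] at h
  simpa using h
end

section
/- Let H₁, …, H_k be complex matrices with H_i of size N×M_i, and suppose the concatenated N×(M₁+⋯+M_k) matrix [H₁ ⋯ H_k] has rank min{N, M₁+⋯+M_k}. Then lim_{ρ→∞} [ log det( I_N + ρ H₁H₁† + ρ H₂H₂† + ⋯ + ρ H_kH_k† ) ] / log ρ = min{N, M₁+⋯+M_k}. -/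
open Matrix
open scoped ComplexOrder

lemma aux_det {N : ℕ} (A : Matrix (Fin N) (Fin N) ℂ) (hA : A.IsHermitian) (ρ : ℝ) :
    (1 + (ρ : ℂ) • A).det = ((∏ i, (1 + ρ * hA.eigenvalues i) : ℝ) : ℂ) := by
  have h := hA.spectral_theorem
  rw [Unitary.conjStarAlgAut_apply] at h
  have hU : (star (hA.eigenvectorUnitary : Matrix (Fin N) (Fin N) ℂ)) *
      (hA.eigenvectorUnitary : Matrix (Fin N) (Fin N) ℂ) = 1 :=
    Unitary.coe_star_mul_self _
  conv_lhs => rw [h]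
  rw [← Matrix.smul_mul, Matrix.det_one_add_mul_comm, Matrix.mul_smul, ← mul_assoc, hU, one_mul]
  rw [← Matrix.diagonal_one, ← Matrix.diagonal_smul, Matrix.diagonal_add, Matrix.det_diagonal]
  simp

lemma aux_lim (l : ℝ) (hl : 0 ≤ l) :
    Filter.Tendsto (fun ρ : ℝ => Real.log (1 + ρ * l) / Real.log ρ) Filter.atTop
      (nhds (if l ≠ 0 then 1 else 0)) := by
  by_cases h0 : l = 0
  · simp [h0]
  · have hpos : 0 < l := lt_of_le_of_ne hl (Ne.symm h0)
    simp only [ne_eq, h0, not_false_eq_true, if_true]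
    have h1 : Filter.Tendsto (fun ρ : ℝ => Real.log (ρ⁻¹ + l)) Filter.atTop
        (nhds (Real.log (0 + l))) :=
      (tendsto_inv_atTop_zero.add_const l).log (by simpa using h0)
    have h2 := (h1.div_atTop Real.tendsto_log_atTop).const_add 1
    rw [add_zero] at h2
    refine h2.congr' ?_
    filter_upwards [Filter.eventually_gt_atTop 1] with ρ hρ
    have hρ0 : 0 < ρ := by linarith
    have hlog : Real.log ρ ≠ 0 := (Real.log_pos hρ).ne'
    have : 1 + ρ * l = ρ * (ρ⁻¹ + l) := by field_simp
    rw [this, Real.log_mul hρ0.ne' (by positivity)]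
    field_simp

/-- For `N × Mᵢ` complex matrices `H₁, …, H_k` whose horizontal
concatenation `[H₁ ⋯ H_k]` has full rank `min{N, M₁ + ⋯ + M_k}`,
`lim_{ρ → ∞} log det(I_N + ρ Σᵢ Hᵢ Hᵢᴴ) / log ρ = min{N, M₁ + ⋯ + M_k}`. -/
theorem log_det_one_add_sum_div_log_tendsto_min
    {k N : ℕ} {Mdim : Fin k → ℕ}
    (H : (i : Fin k) → Matrix (Fin N) (Fin (Mdim i)) ℂ)
    (hrank :
      (Matrix.of fun (n : Fin N) (p : (i : Fin k) × Fin (Mdim i)) => H p.1 n p.2).rank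
        = min N (∑ i, Mdim i)) :
    Filter.Tendsto
      (fun ρ : ℝ =>
        Real.log ((1 + ∑ i, (ρ : ℂ) • (H i * (H i)ᴴ)).det.re) / Real.log ρ)
      Filter.atTop (nhds ((min N (∑ i, Mdim i) : ℕ) : ℝ)) := by
  rw [← hrank]
  set B := (Matrix.of fun (n : Fin N) (p : (i : Fin k) × Fin (Mdim i)) => H p.1 n p.2) with hB
  have hsum : ∑ i, H i * (H i)ᴴ = B * Bᴴ := by
    ext a b
    simp [hB, Matrix.sum_apply, Matrix.mul_apply, Fintype.sum_sigma]
  have hps : (B * Bᴴ).PosSemidef := Matrix.posSemidef_self_mul_conjTranspose B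
  have hA := hps.isHermitian
  rw [← Matrix.rank_self_mul_conjTranspose, hA.rank_eq_card_non_zero_eigs]
  have hlim := tendsto_finsetSum Finset.univ
    (fun i _ => aux_lim (hA.eigenvalues i) (hps.eigenvalues_nonneg i))
  have hc : (∑ i, if hA.eigenvalues i ≠ 0 then (1 : ℝ) else 0)
      = (Fintype.card {i // hA.eigenvalues i ≠ 0} : ℝ) := by
    rw [Finset.sum_boole, Fintype.card_subtype]
  rw [hc] at hlim
  refine hlim.congr' ?_
  filter_upwards [Filter.eventually_gt_atTop 0] with ρ hρ
  rw [← Finset.smul_sum, hsum, aux_det _ hA, Complex.ofReal_re, Real.log_prod, Finset.sum_div]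
  intro i _
  have := hps.eigenvalues_nonneg i
  positivity
end

section
/- Let H₁, …, H_k be invertible M×M complex matrices and α₁, …, α_k ≥ 0 real numbers. Then lim_{ρ→∞} [ log det( I_M + ρ^{α₁} H₁H₁† + ρ^{α₂} H₂H₂† + ⋯ + ρ^{α_k} H_kH_k† ) ] / log ρ = M · max{α₁, …, α_k}. -/
open Matrix

lemma aux_rpow_tendsto (c : ℝ) (hc : c ≤ 0) :
    Filter.Tendsto (fun ρ : ℝ => ρ ^ c) Filter.atTop (nhds (if c = 0 then 1 else 0)) := by
  split_ifs with h
  · subst h; simp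
  · have h1 : 0 < -c := by
      have : c < 0 := lt_of_le_of_ne hc h
      linarith
    simpa using tendsto_rpow_neg_atTop h1

open scoped ComplexOrder in
lemma aux_posDef {k M : ℕ} (H : Fin k → Matrix (Fin M) (Fin M) ℂ)
    (hH : ∀ i, IsUnit (H i).det) (z0 : ℝ) (hz0 : 0 ≤ z0) (z : Fin k → ℝ) (hz : ∀ i, 0 ≤ z i)
    (i₀ : Fin k) (hi₀ : z i₀ = 1) :
    0 < ((z0 : ℂ) • (1 : Matrix (Fin M) (Fin M) ℂ) +
      ∑ i, (z i : ℂ) • (H i * (H i)ᴴ)).det.re := by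
  have hpd : (H i₀ * (H i₀)ᴴ).PosDef := by
    apply Matrix.PosDef.mul_conjTranspose_self
    exact Matrix.vecMul_injective_of_isUnit ((Matrix.isUnit_iff_isUnit_det _).2 (hH i₀))
  have hs : ∀ i, ((z i : ℂ) • (H i * (H i)ᴴ)).PosSemidef := fun i =>
    (Matrix.posSemidef_self_mul_conjTranspose (H i)).smul (by exact_mod_cast hz i)
  have h1 : ((z0 : ℂ) • (1 : Matrix (Fin M) (Fin M) ℂ)).PosSemidef :=
    Matrix.PosSemidef.one.smul (by exact_mod_cast hz0)
  have hsum : (∑ i, (z i : ℂ) • (H i * (H i)ᴴ)).PosDef := by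
    rw [← Finset.add_sum_erase _ _ (Finset.mem_univ i₀), hi₀]
    refine Matrix.PosDef.add_posSemidef (by simpa using hpd) ?_
    exact Matrix.posSemidef_sum _ (fun i _ => hs i)
  have := (Matrix.PosDef.posSemidef_add h1 hsum).det_pos
  exact (Complex.pos_iff.1 this).1

/-- For invertible `M × M` complex matrices `H₁, …, H_k` and
exponents `α₁, …, α_k ≥ 0`,
`lim_{ρ → ∞} log det(I_M + Σᵢ ρ^{αᵢ} Hᵢ Hᵢᴴ) / log ρ = M · max{α₁, …, α_k}`. -/
theorem log_det_one_add_sum_rpow_div_log_tendsto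
    {k M : ℕ} (hk : 0 < k)
    (H : Fin k → Matrix (Fin M) (Fin M) ℂ) (hH : ∀ i, IsUnit (H i).det)
    (α : Fin k → ℝ) (hα : ∀ i, 0 ≤ α i) :
    Filter.Tendsto
      (fun ρ : ℝ =>
        Real.log ((1 + ∑ i, ((ρ ^ α i : ℝ) : ℂ) • (H i * (H i)ᴴ)).det.re) /
          Real.log ρ)
      Filter.atTop (nhds ((M : ℝ) * ⨆ i, α i)) := by
  have : Nonempty (Fin k) := ⟨⟨0, hk⟩⟩
  obtain ⟨i₀, hi₀⟩ := exists_eq_ciSup_of_finite (f := α)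
  have hle : ∀ i, α i ≤ ⨆ i, α i := fun i => le_ciSup (Set.finite_range α).bddAbove i
  set a := ⨆ i, α i with ha
  have ha0 : 0 ≤ a := hi₀ ▸ hα i₀
  let D : ℝ → ℝ := fun ρ => (((ρ ^ (-a) : ℝ) : ℂ) • (1 : Matrix (Fin M) (Fin M) ℂ) +
      ∑ i, ((ρ ^ (α i - a) : ℝ) : ℂ) • (H i * (H i)ᴴ)).det.re
  let d : ℝ := (((if -a = 0 then 1 else 0 : ℝ) : ℂ) • (1 : Matrix (Fin M) (Fin M) ℂ) +
      ∑ i, ((if α i - a = 0 then 1 else 0 : ℝ) : ℂ) • (H i * (H i)ᴴ)).det.re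
  have hd : 0 < d := by
    refine aux_posDef H hH _ ?_ (fun i => if α i - a = 0 then 1 else 0) ?_ i₀ ?_
    · split_ifs <;> norm_num
    · intro i; split_ifs <;> norm_num
    · simp [hi₀]
  have hD : Filter.Tendsto D Filter.atTop (nhds d) := by
    have hdet : Continuous fun A : Matrix (Fin M) (Fin M) ℂ => A.det.re :=
      Complex.continuous_re.comp (Continuous.matrix_det continuous_id)
    refine (hdet.tendsto _).comp (Filter.Tendsto.add ?_ (tendsto_finsetSum _ fun i _ => ?_))
    · exact ((Complex.continuous_ofReal.tendsto _).comp
        (aux_rpow_tendsto (-a) (by linarith))).smul_const _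
    · exact ((Complex.continuous_ofReal.tendsto _).comp
        (aux_rpow_tendsto (α i - a) (by linarith [hle i]))).smul_const _
  have hlim : Filter.Tendsto (fun ρ => (M : ℝ) * a + Real.log (D ρ) / Real.log ρ)
      Filter.atTop (nhds ((M : ℝ) * a)) := by
    have h := (hD.log hd.ne').div_atTop Real.tendsto_log_atTop
    simpa using h.const_add ((M : ℝ) * a)
  refine hlim.congr' ?_
  filter_upwards [hD.eventually (lt_mem_nhds hd), Filter.eventually_gt_atTop (1 : ℝ)] with ρ hpos h1
  have hρ : 0 < ρ := by linarith
  have hlog : 0 < Real.log ρ := Real.log_pos h1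
  have hmat : (1 + ∑ i, ((ρ ^ α i : ℝ) : ℂ) • (H i * (H i)ᴴ)) =
      ((ρ ^ a : ℝ) : ℂ) • (((ρ ^ (-a) : ℝ) : ℂ) • (1 : Matrix (Fin M) (Fin M) ℂ) +
      ∑ i, ((ρ ^ (α i - a) : ℝ) : ℂ) • (H i * (H i)ᴴ)) := by
    rw [smul_add, Finset.smul_sum, smul_smul, ← Complex.ofReal_mul, ← Real.rpow_add hρ]
    congr 1
    · simp
    · refine Finset.sum_congr rfl fun i _ => ?_
      rw [smul_smul, ← Complex.ofReal_mul, ← Real.rpow_add hρ]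
      congr 3
      ring_nf
  have hdet : (1 + ∑ i, ((ρ ^ α i : ℝ) : ℂ) • (H i * (H i)ᴴ)).det.re = (ρ ^ a) ^ M * D ρ := by
    rw [hmat, Matrix.det_smul, Fintype.card_fin, ← Complex.ofReal_pow, Complex.re_ofReal_mul]
  rw [hdet, Real.log_mul (by positivity) hpos.ne', Real.log_pow, Real.log_rpow hρ]
  field_simp
end

section
/- Let H and G be invertible M×M complex matrices and α ≥ 0 a real number. Then lim_{ρ→∞} [ log det( I_M + ρ H H† − ρ^{1+α} H G† (I_M + ρ^α G G†)⁻¹ G H† ) ] / log ρ = M · (1−α)⁺, where the matrix inside the determinant is Hermitian positive definite for every ρ > 0 (it equals I_M + ρ H (I_M + ρ^α G† G)⁻¹ H†). -/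
open Matrix

open Filter Topology ComplexOrder

lemma aux_rpow (s : ℝ) (hs : s ≤ 0) : ∃ c : ℝ, 0 ≤ c ∧ (s = 0 → 0 < c) ∧
    Tendsto (fun ρ : ℝ => ((ρ ^ s : ℝ) : ℂ)) atTop (𝓝 (c : ℂ)) := by
  rcases hs.eq_or_lt with h | h
  · subst h
    exact ⟨1, zero_le_one, fun _ => one_pos, by simp⟩
  · refine ⟨0, le_rfl, fun h' => absurd h' h.ne, ?_⟩
    have := tendsto_rpow_neg_atTop (y := -s) (by linarith)
    rw [neg_neg] at this
    exact (Complex.continuous_ofReal.tendsto 0).comp this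

lemma aux_det_s9 {M : ℕ} (H G : Matrix (Fin M) (Fin M) ℂ) (ρ c : ℂ) 
    (hS : IsUnit (1 + c • (Gᴴ * G)).det) (hT : IsUnit (1 + c • (G * Gᴴ)).det) :
    (1 + ρ • (H * Hᴴ) - (ρ * c) • (H * Gᴴ * (1 + c • (G * Gᴴ))⁻¹ * (G * Hᴴ))).det
      = (1 + c • (Gᴴ * G) + ρ • (Hᴴ * H)).det / (1 + c • (Gᴴ * G)).det := by
  set S := 1 + c • (Gᴴ * G) with hSd
  set T := 1 + c • (G * Gᴴ) with hTd
  have h1 : S * Gᴴ = Gᴴ * T := by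
    simp [hSd, hTd, add_mul, mul_add, Matrix.mul_assoc]
  have h2 : Gᴴ * T⁻¹ = S⁻¹ * Gᴴ := by
    calc Gᴴ * T⁻¹ = S⁻¹ * (S * Gᴴ) * T⁻¹ := by
          rw [← Matrix.mul_assoc, Matrix.nonsing_inv_mul _ hS, Matrix.one_mul]
      _ = S⁻¹ * Gᴴ := by
          rw [h1, Matrix.mul_assoc, Matrix.mul_assoc, Matrix.mul_nonsing_inv _ hT, Matrix.mul_one]
  have h3 : c • (S⁻¹ * (Gᴴ * G)) = 1 - S⁻¹ := by
    have : c • (Gᴴ * G) = S - 1 := by simp [hSd]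
    rw [← Matrix.mul_smul, this, mul_sub, Matrix.nonsing_inv_mul _ hS, Matrix.mul_one]
  have h4 : (1 + ρ • (H * Hᴴ) - (ρ * c) • (H * Gᴴ * T⁻¹ * (G * Hᴴ)))
      = 1 + H * (ρ • (S⁻¹ * Hᴴ)) := by
    have : H * Gᴴ * T⁻¹ * (G * Hᴴ) = H * (S⁻¹ * (Gᴴ * G)) * Hᴴ := by
      rw [Matrix.mul_assoc H, h2]; simp only [Matrix.mul_assoc]
    have h5 : c • (H * (S⁻¹ * (Gᴴ * G)) * Hᴴ) = H * (1 - S⁻¹) * Hᴴ := by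
      rw [← h3, Matrix.mul_smul, Matrix.smul_mul]
    rw [this, mul_smul, h5]
    simp only [mul_sub, sub_mul, Matrix.mul_one, smul_sub, Matrix.mul_smul, Matrix.mul_assoc]
    abel
  rw [h4, Matrix.det_one_add_mul_comm, eq_div_iff hS.ne_zero, mul_comm, ← Matrix.det_mul]
  congr 1
  rw [mul_add, Matrix.mul_one, Matrix.smul_mul, Matrix.mul_smul, Matrix.mul_assoc,
    ← Matrix.mul_assoc S, Matrix.mul_nonsing_inv _ hS, Matrix.one_mul]

lemma aux_pd {M : ℕ} (G : Matrix (Fin M) (Fin M) ℂ) (hG : IsUnit G.det) : (Gᴴ * G).PosDef := by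
  apply Matrix.PosDef.conjTranspose_mul_self
  exact Matrix.mulVec_injective_iff_isUnit.2 ((Matrix.isUnit_iff_isUnit_det _).2 hG)

lemma aux_smul {M : ℕ} {A : Matrix (Fin M) (Fin M) ℂ} (hA : A.PosDef) {c : ℝ} (hc : 0 < c) :
    ((c : ℂ) • A).PosDef := hA.smul (by exact_mod_cast hc)

lemma aux_smul' {M : ℕ} {A : Matrix (Fin M) (Fin M) ℂ} (hA : A.PosDef) {c : ℝ} (hc : 0 ≤ c) :
    ((c : ℂ) • A).PosSemidef := hA.posSemidef.smul (by exact_mod_cast hc)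

/-- For invertible `M × M` complex matrices `H`, `G` and `α ≥ 0`,
`lim_{ρ → ∞} log det(I_M + ρ H Hᴴ − ρ^{1+α} H Gᴴ (I_M + ρ^α G Gᴴ)⁻¹ G Hᴴ) / log ρ
  = M · (1 − α)⁺`. -/
theorem log_det_residual_div_log_tendsto_pos_part_one_sub
    {M : ℕ} (H G : Matrix (Fin M) (Fin M) ℂ)
    (hH : IsUnit H.det) (hG : IsUnit G.det) (α : ℝ) (hα : 0 ≤ α) :
    Filter.Tendsto
      (fun ρ : ℝ =>
        Real.log
          ((1 + (ρ : ℂ) • (H * Hᴴ) -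
              ((ρ ^ (1 + α) : ℝ) : ℂ) •
                (H * Gᴴ * (1 + ((ρ ^ α : ℝ) : ℂ) • (G * Gᴴ))⁻¹ * (G * Hᴴ))).det.re) /
          Real.log ρ)
      Filter.atTop (nhds ((M : ℝ) * max (1 - α) 0)) := by
  have hP := aux_pd H hH
  have hQ := aux_pd G hG
  have hQ' : (G * Gᴴ).PosDef := by
    have := aux_pd Gᴴ (by rw [Matrix.det_conjTranspose]; exact hG.star)
    rwa [conjTranspose_conjTranspose] at this
  set P := Hᴴ * H with hPd
  set Q := Gᴴ * G with hQd
  set m := max 1 α with hm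
  have hm1 : 1 ≤ m := le_max_left _ _
  have hmα : α ≤ m := le_max_right _ _
  have hme : max (1 - α) 0 = m - α := by
    rw [hm, max_sub_sub_right 1 α α |>.symm, sub_self]
  obtain ⟨c1, h1, h1', t1⟩ := aux_rpow (-m) (by linarith)
  obtain ⟨c2, h2, h2', t2⟩ := aux_rpow (α - m) (by linarith)
  obtain ⟨c3, h3, h3', t3⟩ := aux_rpow (1 - m) (by linarith)
  obtain ⟨c4, h4, h4', t4⟩ := aux_rpow (-α) (by linarith)
  have pd1 : (∀ {A : Matrix (Fin M) (Fin M) ℂ}, A.PosDef → 0 < A.det) := fun h => h.det_pos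
  have I1 : (1 : Matrix (Fin M) (Fin M) ℂ).PosDef := Matrix.PosDef.one
  have pA : ((c1 : ℂ) • (1 : Matrix (Fin M) (Fin M) ℂ) + (c2 : ℂ) • Q + (c3 : ℂ) • P).PosDef := by
    rcases le_total α 1 with h | h
    · exact Matrix.PosDef.posSemidef_add ((aux_smul' I1 h1).add (aux_smul' hQ h2))
        (aux_smul hP (h3' (by rw [hm, max_eq_left h]; ring)))
    · exact Matrix.PosDef.add_posSemidef (Matrix.PosDef.posSemidef_add (aux_smul' I1 h1)
        (aux_smul hQ (h2' (by rw [hm, max_eq_right h]; ring)))) (aux_smul' hP h3)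
  have pB : ((c4 : ℂ) • (1 : Matrix (Fin M) (Fin M) ℂ) + Q).PosDef :=
    Matrix.PosDef.posSemidef_add (aux_smul' I1 h4) hQ
  set A := ((c1 : ℂ) • (1 : Matrix (Fin M) (Fin M) ℂ) + (c2 : ℂ) • Q + (c3 : ℂ) • P)
  set B := ((c4 : ℂ) • (1 : Matrix (Fin M) (Fin M) ℂ) + Q)
  have hL : 0 < (A.det / B.det).re := by
    have : 0 < A.det / B.det := div_pos pA.det_pos pB.det_pos
    exact (Complex.pos_iff.1 this).1
  let g : ℝ → ℂ := fun ρ =>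
    (((ρ ^ (-m) : ℝ) : ℂ) • (1 : Matrix (Fin M) (Fin M) ℂ) + ((ρ ^ (α - m) : ℝ) : ℂ) • Q +
      ((ρ ^ (1 - m) : ℝ) : ℂ) • P).det /
    (((ρ ^ (-α) : ℝ) : ℂ) • (1 : Matrix (Fin M) (Fin M) ℂ) + Q).det
  have hg : Tendsto g atTop (𝓝 (A.det / B.det)) := by
    refine Tendsto.div ?_ ?_ pB.det_pos.ne'
    · exact (continuous_id.matrix_det.tendsto A).comp
        (((t1.smul_const _).add (t2.smul_const _)).add (t3.smul_const _))
    · exact (continuous_id.matrix_det.tendsto B).comp ((t4.smul_const _).add_const _)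
  have hgr : Tendsto (fun ρ => (g ρ).re) atTop (𝓝 (A.det / B.det).re) :=
    (Complex.continuous_re.tendsto _).comp hg
  have hlog : Tendsto (fun ρ => (M : ℝ) * max (1 - α) 0 + Real.log ((g ρ).re) / Real.log ρ) atTop
      (𝓝 ((M : ℝ) * max (1 - α) 0 + 0)) :=
    tendsto_const_nhds.add ((hgr.log hL.ne').div_atTop Real.tendsto_log_atTop)
  rw [add_zero] at hlog
  refine hlog.congr' ?_
  filter_upwards [eventually_gt_atTop 1, hgr.eventually_const_lt hL] with ρ hρ hgp
  have hρ0 : 0 < ρ := by linarith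
  have hl : 0 < Real.log ρ := Real.log_pos hρ
  have hc : 0 < ρ ^ α := Real.rpow_pos_of_pos hρ0 _
  have eS := (I1.add (aux_smul hQ hc)).det_pos.ne'
  have eT := (I1.add (aux_smul hQ' hc)).det_pos.ne'
  have key := aux_det_s9 H G (ρ : ℂ) ((ρ ^ α : ℝ) : ℂ) eS.isUnit eT.isUnit
  have e1 : ((ρ ^ (1 + α) : ℝ) : ℂ) = (ρ : ℂ) * ((ρ ^ α : ℝ) : ℂ) := by
    rw [Real.rpow_add hρ0, Real.rpow_one]; push_cast; rfl
  rw [e1, key]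
  have n1 : 1 + ((ρ ^ α : ℝ) : ℂ) • Q + (ρ : ℂ) • P = ((ρ ^ m : ℝ) : ℂ) •
    (((ρ ^ (-m) : ℝ) : ℂ) • (1 : Matrix (Fin M) (Fin M) ℂ) + ((ρ ^ (α - m) : ℝ) : ℂ) • Q +
      ((ρ ^ (1 - m) : ℝ) : ℂ) • P) := by
    simp only [smul_add, smul_smul, ← Complex.ofReal_mul, ← Real.rpow_add hρ0]
    simp
  have n2 : 1 + ((ρ ^ α : ℝ) : ℂ) • Q = ((ρ ^ α : ℝ) : ℂ) •
    (((ρ ^ (-α) : ℝ) : ℂ) • (1 : Matrix (Fin M) (Fin M) ℂ) + Q) := by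
    simp only [smul_add, smul_smul, ← Complex.ofReal_mul, ← Real.rpow_add hρ0]
    simp
  have n3 : (1 + ((ρ ^ α : ℝ) : ℂ) • Q + (ρ : ℂ) • P).det / (1 + ((ρ ^ α : ℝ) : ℂ) • Q).det
      = (((ρ ^ (m - α)) ^ M : ℝ) : ℂ) * g ρ := by
    rw [n1, n2, Matrix.det_smul, Matrix.det_smul, mul_div_mul_comm, Fintype.card_fin, ← div_pow,
      Real.rpow_sub hρ0 m α]
    push_cast
    rfl
  rw [n3, Complex.re_ofReal_mul, Real.log_mul (by positivity) hgp.ne', Real.log_pow,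
    Real.log_rpow hρ0, hme]
  field_simp
end

section
/- Let H be an N×M complex matrix and G an N'×M complex matrix, and let P_H be the M×M matrix of the orthogonal projection onto the kernel of H (i.e., P_H is Hermitian, P_H² = P_H, H P_H = 0, and P_H v = v for every v ∈ ℂ^M with H v = 0). Assume that rank(G P_H) = min{N', (M−N)⁺}. Then lim_{ρ→∞} [ log det( I_{N'} + ρ G G† − ρ² G H† (I_N + ρ H H†)⁻¹ H G† ) ] / log ρ = min{N', (M−N)⁺}, where the matrix inside the determinant is Hermitian positive definite for every ρ > 0. -/
open Matrix
open scoped ComplexOrder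

set_option linter.unusedSimpArgs false

/-- Diagonal case of the determinant asymptotics. -/
lemma aux_diag {n : ℕ} (D : Fin n → ℝ) (B : ℝ → Matrix (Fin n) (Fin n) ℂ)
    (B0 : Matrix (Fin n) (Fin n) ℂ) (hB0 : B0.PosDef)
    (hB : Filter.Tendsto B Filter.atTop (nhds B0)) :
    ∃ L : ℂ, L ≠ 0 ∧ Filter.Tendsto
      (fun ρ : ℝ => (B ρ + (ρ : ℂ) • diagonal (fun i => (D i : ℂ))).det /
        (ρ : ℂ) ^ (Fintype.card {i // D i ≠ 0})) Filter.atTop (nhds L) := by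
  classical
  set E : ℝ → Fin n → ℂ := fun ρ i => if D i ≠ 0 then ((ρ⁻¹ : ℝ) : ℂ) else 1 with hE
  set E0 : Fin n → ℂ := fun i => if D i ≠ 0 then 0 else 1 with hE0
  have hEt : Filter.Tendsto E Filter.atTop (nhds E0) := by
    rw [tendsto_pi_nhds]
    intro i
    by_cases h : D i = 0
    · simp [hE, hE0, h]
    · simp only [hE, hE0, h, ne_eq, not_false_eq_true, if_true]
      have := (Complex.continuous_ofReal.tendsto 0).comp tendsto_inv_atTop_zero
      simpa [Function.comp_def] using this
  refine ⟨(B0 * diagonal E0 + diagonal (fun i => (D i : ℂ))).det, ?_, ?_⟩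
  · intro hdet
    obtain ⟨v, hv, hv0⟩ := Matrix.exists_mulVec_eq_zero_iff.mpr hdet
    apply hv
    set w : Fin n → ℂ := fun i => E0 i * v i with hw
    have h1 : B0 *ᵥ w + (fun i => (D i : ℂ) * v i) = 0 := by
      rw [Matrix.add_mulVec, ← Matrix.mulVec_mulVec] at hv0
      have e1 : diagonal E0 *ᵥ v = w := by
        ext i; simp [Matrix.mulVec_diagonal, hw]
      have e2 : diagonal (fun i => (D i : ℂ)) *ᵥ v = (fun i => (D i : ℂ) * v i) := by
        ext i; simp [Matrix.mulVec_diagonal]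
      rw [e1, e2] at hv0
      exact hv0
    have hw0 : w = 0 := by
      by_contra hne
      have hp := hB0.dotProduct_mulVec_pos hne
      have h2 : star w ⬝ᵥ (B0 *ᵥ w) = 0 := by
        have h3 : B0 *ᵥ w = -(fun i => (D i : ℂ) * v i) := eq_neg_of_add_eq_zero_left h1
        rw [h3]
        simp only [dotProduct]
        apply Finset.sum_eq_zero
        intro i _
        by_cases h : D i = 0
        · simp [h]
        · simp [hw, hE0, h]
      rw [h2] at hp
      exact lt_irrefl _ hp
    rw [hw0, Matrix.mulVec_zero, zero_add] at h1
    ext i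
    by_cases h : D i = 0
    · have := congrFun hw0 i
      simpa [hw, hE0, h] using this
    · have := congrFun h1 i
      simpa [h] using this
  · have hlim : Filter.Tendsto (fun ρ => (B ρ * diagonal (E ρ) + diagonal (fun i => (D i : ℂ))).det)
        Filter.atTop (nhds (B0 * diagonal E0 + diagonal (fun i => (D i : ℂ))).det) := by
      have hdg : Filter.Tendsto (fun ρ => (diagonal (E ρ) : Matrix (Fin n) (Fin n) ℂ)) Filter.atTop
          (nhds (diagonal E0)) :=
        ((continuous_id.matrix_diagonal).tendsto E0).comp hEt
      have hsum := (hB.mul hdg).add_const (diagonal (fun i => (D i : ℂ)))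
      exact ((continuous_id.matrix_det).tendsto _).comp hsum
    refine hlim.congr' ?_
    filter_upwards [Filter.eventually_gt_atTop 0] with ρ hρ
    have hρ' : (ρ : ℂ) ≠ 0 := by exact_mod_cast hρ.ne'
    have hm : B ρ * diagonal (E ρ) + diagonal (fun i => (D i : ℂ)) =
        (B ρ + (ρ : ℂ) • diagonal (fun i => (D i : ℂ))) * diagonal (E ρ) := by
      rw [add_mul, smul_mul_assoc, diagonal_mul_diagonal, ← diagonal_smul]
      congr 2
      ext i
      by_cases h : D i = 0
      · simp [h]
      · simp [hE, h]
        field_simp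
    rw [hm, det_mul, det_diagonal, div_eq_mul_inv]
    congr 1
    simp only [hE]
    rw [Finset.prod_ite]
    simp [Fintype.card_subtype]

lemma aux_herm {n : ℕ} (Q : Matrix (Fin n) (Fin n) ℂ) (hQ : Q.IsHermitian)
    (B : ℝ → Matrix (Fin n) (Fin n) ℂ)
    (B0 : Matrix (Fin n) (Fin n) ℂ) (hB0 : B0.PosDef)
    (hB : Filter.Tendsto B Filter.atTop (nhds B0)) :
    ∃ L : ℂ, L ≠ 0 ∧ Filter.Tendsto
      (fun ρ : ℝ => (B ρ + (ρ : ℂ) • Q).det / (ρ : ℂ) ^ Q.rank) Filter.atTop (nhds L) := by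
  classical
  set U : Matrix (Fin n) (Fin n) ℂ := (hQ.eigenvectorUnitary : Matrix (Fin n) (Fin n) ℂ) with hU
  have hUU : Uᴴ * U = 1 := by
    have := Unitary.coe_star_mul_self hQ.eigenvectorUnitary
    simpa [star_eq_conjTranspose] using this
  have hUU' : U * Uᴴ = 1 := mul_eq_one_comm.mp hUU
  have hsp : Q = U * diagonal (fun i => (hQ.eigenvalues i : ℂ)) * Uᴴ := by
    have := hQ.spectral_theorem
    rw [Unitary.conjStarAlgAut_apply] at this
    exact this
  have hinj : Function.Injective U.mulVec := by
    intro x y hxy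
    have := congrArg (fun z => Uᴴ *ᵥ z) hxy
    simpa [Matrix.mulVec_mulVec, hUU] using this
  have hpd : (Uᴴ * B0 * U).PosDef := hB0.conjTranspose_mul_mul_same hinj
  have ht : Filter.Tendsto (fun ρ => Uᴴ * B ρ * U) Filter.atTop (nhds (Uᴴ * B0 * U)) := by
    have hc : Continuous (fun X : Matrix (Fin n) (Fin n) ℂ => Uᴴ * X * U) := by fun_prop
    exact (hc.tendsto B0).comp hB
  obtain ⟨L, hL, hLt⟩ := aux_diag hQ.eigenvalues _ _ hpd ht
  refine ⟨L, hL, ?_⟩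
  refine hLt.congr ?_
  intro ρ
  rw [hQ.rank_eq_card_non_zero_eigs]
  congr 1
  have hm : Uᴴ * B ρ * U + (ρ : ℂ) • diagonal (fun i => (hQ.eigenvalues i : ℂ)) =
      Uᴴ * (B ρ + (ρ : ℂ) • Q) * U := by
    have hd : Uᴴ * Q * U = diagonal (fun i => (hQ.eigenvalues i : ℂ)) := by
      conv_lhs => rw [hsp]
      calc _ = (Uᴴ * U) * diagonal (fun i => (hQ.eigenvalues i : ℂ)) * (Uᴴ * U) := by
            simp only [Matrix.mul_assoc]
        _ = _ := by rw [hUU, one_mul, mul_one]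
    rw [mul_add, add_mul, mul_smul_comm, smul_mul_assoc, hd]
  rw [hm, det_mul, det_mul, mul_right_comm, ← det_mul, hUU, det_one, one_mul]

lemma aux_isUnit_one_add {n m : ℕ} (H : Matrix (Fin n) (Fin m) ℂ) {ρ : ℝ} (hρ : 0 < ρ) :
    IsUnit (1 + (ρ : ℂ) • (H * Hᴴ)).det := by
  have h1 : (1 : Matrix (Fin n) (Fin n) ℂ).PosDef := Matrix.PosDef.one
  have h2 : ((ρ : ℂ) • (H * Hᴴ)).PosSemidef :=
    (posSemidef_self_mul_conjTranspose H).smul (by exact_mod_cast hρ.le)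
  exact (isUnit_iff_isUnit_det _).mp (h1.add_posSemidef h2).isUnit

/-- The kernel identity. -/
lemma aux_identity {M N : ℕ}
    (H : Matrix (Fin N) (Fin M) ℂ) (P : Matrix (Fin M) (Fin M) ℂ)
    (hPherm : P.IsHermitian) (hPproj : P * P = P) (hHP : H * P = 0)
    {ρ : ℝ} (hρ : 0 < ρ)
    (hT : IsUnit (((ρ⁻¹ : ℝ) : ℂ) • 1 + (Hᴴ * H + P)).det) :
    (ρ : ℂ) • (1 : Matrix (Fin M) (Fin M) ℂ) -
      ((ρ ^ 2 : ℝ) : ℂ) • (Hᴴ * (1 + (ρ : ℂ) • (H * Hᴴ))⁻¹ * H) =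
    (ρ : ℂ) • P + (((ρ⁻¹ : ℝ) : ℂ) • 1 + (Hᴴ * H + P))⁻¹ * (1 - P) := by
  have hρ' : (ρ : ℂ) ≠ 0 := by exact_mod_cast hρ.ne'
  have hPH : P * Hᴴ = 0 := by
    have := congrArg conjTranspose hHP
    simpa [conjTranspose_mul, hPherm.eq] using this
  set W := (1 + (ρ : ℂ) • (H * Hᴴ))⁻¹ with hW
  have hW1 : (1 + (ρ : ℂ) • (H * Hᴴ)) * W = 1 :=
    Matrix.mul_nonsing_inv _ (aux_isUnit_one_add H hρ)
  set R := ((ρ⁻¹ : ℝ) : ℂ) • (1 : Matrix (Fin M) (Fin M) ℂ) + (Hᴴ * H + P) with hR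
  have hT1 : R⁻¹ * R = 1 := Matrix.nonsing_inv_mul _ hT
  set Z := ((ρ⁻¹ : ℝ) : ℂ) • (1 : Matrix (Fin M) (Fin M) ℂ) + Hᴴ * H with hZ
  have hHHW : H * Hᴴ * W = (ρ : ℂ)⁻¹ • (1 - W) := by
    rw [add_mul, one_mul, smul_mul_assoc] at hW1
    rw [← hW1, add_sub_cancel_left, smul_smul, inv_mul_cancel₀ hρ', one_smul]
  have hZX : Z * ((ρ : ℂ) • (1 : Matrix (Fin M) (Fin M) ℂ) -
      ((ρ ^ 2 : ℝ) : ℂ) • (Hᴴ * W * H)) = 1 := by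
    have e : Hᴴ * H * (Hᴴ * W * H) = (ρ : ℂ)⁻¹ • (Hᴴ * H - Hᴴ * W * H) := by
      calc _ = Hᴴ * (H * Hᴴ * W) * H := by simp only [Matrix.mul_assoc]
        _ = _ := by rw [hHHW]; simp [Matrix.mul_sub, Matrix.sub_mul]
    simp only [hZ, mul_sub, add_mul, mul_smul_comm, mul_one, smul_mul_assoc, one_mul, e]
    push_cast
    match_scalars <;> field_simp <;> ring
  have hYZ : ((ρ : ℂ) • P + R⁻¹ * (1 - P)) * Z = 1 := by
    have e1 : P * Z = (ρ : ℂ)⁻¹ • P := by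
      rw [hZ, mul_add, ← Matrix.mul_assoc, hPH]; simp
    have e2 : (1 - P) * Z = R * (1 - P) := by
      have e3 : R * P = (ρ : ℂ)⁻¹ • P + P := by
        rw [hR, add_mul, add_mul, Matrix.mul_assoc, hHP, hPproj]; simp
      rw [sub_mul, e1, mul_sub, e3, hR, hZ, one_mul, mul_one]
      abel
    rw [add_mul, smul_mul_assoc, e1, Matrix.mul_assoc, e2, ← Matrix.mul_assoc, hT1, smul_smul,
      mul_inv_cancel₀ hρ']
    simp
  exact (left_inv_eq_right_inv hYZ hZX).symm

/-- Let `H : N × M`, `G : N' × M` be complex matrices and `P_H`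
the orthogonal projection onto `ker H`.  If `rank(G P_H) = min{N', (M − N)⁺}`,
then
`lim_{ρ → ∞} log det(I_{N'} + ρ G Gᴴ − ρ² G Hᴴ (I_N + ρ H Hᴴ)⁻¹ H Gᴴ) / log ρ
  = min{N', (M − N)⁺}`. -/
theorem log_det_residual_div_log_tendsto_min_sub'
    {M N N' : ℕ}
    (H : Matrix (Fin N) (Fin M) ℂ) (G : Matrix (Fin N') (Fin M) ℂ)
    (PH : Matrix (Fin M) (Fin M) ℂ)
    (hPherm : PH.IsHermitian) (hPproj : PH * PH = PH) (hHP : H * PH = 0)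
    (hker : ∀ v : Fin M → ℂ, H.mulVec v = 0 → PH.mulVec v = v)
    (hrank : (G * PH).rank = min N' (M - N)) :
    Filter.Tendsto
      (fun ρ : ℝ =>
        Real.log
          ((1 + (ρ : ℂ) • (G * Gᴴ) -
              ((ρ ^ 2 : ℝ) : ℂ) •
                (G * Hᴴ * (1 + (ρ : ℂ) • (H * Hᴴ))⁻¹ * (H * Gᴴ))).det.re) /
          Real.log ρ)
      Filter.atTop (nhds ((min N' (M - N) : ℕ) : ℝ)) := by
  classical
  set S := Hᴴ * H + PH with hS
  have hPP : PH.PosSemidef := by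
    have := posSemidef_conjTranspose_mul_self PH
    rwa [hPherm.eq, hPproj] at this
  have hHH : (Hᴴ * H).PosSemidef := posSemidef_conjTranspose_mul_self H
  have hSps : S.PosSemidef := hHH.add hPP
  have hPH' : PH * Hᴴ = 0 := by
    have := congrArg conjTranspose hHP
    simpa [conjTranspose_mul, hPherm.eq] using this
  have hSP : S * PH = PH := by
    rw [hS, add_mul, Matrix.mul_assoc, hHP, hPproj]; simp
  have hPS : PH * S = PH := by
    rw [hS, mul_add, ← Matrix.mul_assoc, hPH', hPproj]; simp
  have hSu : IsUnit S.det := by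
    rw [isUnit_iff_ne_zero]
    intro hdet
    obtain ⟨v, hv, hv0⟩ := Matrix.exists_mulVec_eq_zero_iff.mpr hdet
    apply hv
    have hp : PH *ᵥ v = 0 := by
      rw [← hPS, ← Matrix.mulVec_mulVec, hv0, Matrix.mulVec_zero]
    have hh : (Hᴴ * H) *ᵥ v = 0 := by
      rw [hS, Matrix.add_mulVec, hp, add_zero] at hv0
      exact hv0
    have hh' : H *ᵥ v = 0 := (Matrix.conjTranspose_mul_self_mulVec_eq_zero H v).mp hh
    rw [← hker v hh', hp]
  have hSinv : S⁻¹.PosSemidef := hSps.inv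
  have hSiP : S⁻¹ * PH = PH := by
    conv_lhs => rw [← hSP, ← Matrix.mul_assoc, Matrix.nonsing_inv_mul _ hSu, one_mul]
  have hPSi : PH * S⁻¹ = PH := by
    conv_lhs => rw [← hPS, Matrix.mul_assoc, Matrix.mul_nonsing_inv _ hSu, mul_one]
  have hC : (G * (S⁻¹ * (1 - PH)) * Gᴴ).PosSemidef := by
    have h1 := hSinv.mul_mul_conjTranspose_same (G * (1 - PH))
    have h2 : G * (1 - PH) * S⁻¹ * (G * (1 - PH))ᴴ = G * (S⁻¹ * (1 - PH)) * Gᴴ := by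
      have h3 : (1 - PH) * S⁻¹ * (1 - PH) = S⁻¹ * (1 - PH) := by
        simp only [sub_mul, mul_sub, one_mul, mul_one, hPSi, hSiP, hPproj]
        abel
      rw [← h3, conjTranspose_mul, conjTranspose_sub, hPherm.eq, conjTranspose_one]
      simp only [Matrix.mul_assoc]
    rwa [h2] at h1
  have hB0 : (1 + G * (S⁻¹ * (1 - PH)) * Gᴴ).PosDef := Matrix.PosDef.one.add_posSemidef hC
  have hBt : Filter.Tendsto
      (fun ρ : ℝ => 1 + G * ((((ρ⁻¹ : ℝ) : ℂ) • 1 + S)⁻¹ * (1 - PH)) * Gᴴ) Filter.atTop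
      (nhds (1 + G * (S⁻¹ * (1 - PH)) * Gᴴ)) := by
    have h0 : Filter.Tendsto (fun ρ : ℝ => ((ρ⁻¹ : ℝ) : ℂ)) Filter.atTop (nhds 0) := by
      have := (Complex.continuous_ofReal.tendsto 0).comp tendsto_inv_atTop_zero
      simpa [Function.comp_def] using this
    have h1 : Filter.Tendsto (fun ρ : ℝ => ((ρ⁻¹ : ℝ) : ℂ) • (1 : Matrix (Fin M) (Fin M) ℂ) + S)
        Filter.atTop (nhds S) := by
      have := (h0.smul_const (1 : Matrix (Fin M) (Fin M) ℂ)).add_const S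
      simpa using this
    have h2 : Filter.Tendsto
        (fun ρ : ℝ => (((ρ⁻¹ : ℝ) : ℂ) • (1 : Matrix (Fin M) (Fin M) ℂ) + S)⁻¹)
        Filter.atTop (nhds S⁻¹) := by
      simp only [Matrix.inv_def, Ring.inverse_eq_inv']
      have hd := (continuous_id.matrix_det.tendsto S).comp h1
      have ha := (continuous_id.matrix_adjugate.tendsto S).comp h1
      exact (hd.inv₀ hSu.ne_zero).smul ha
    have hc : Continuous (fun X : Matrix (Fin M) (Fin M) ℂ => 1 + G * (X * (1 - PH)) * Gᴴ) := by
      fun_prop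
    exact (hc.tendsto _).comp h2
  have hQe : G * PH * (G * PH)ᴴ = G * PH * Gᴴ := by
    rw [conjTranspose_mul, hPherm.eq, ← Matrix.mul_assoc, Matrix.mul_assoc G, hPproj]
  have hQ : (G * PH * Gᴴ).IsHermitian := by
    rw [← hQe]; exact isHermitian_mul_conjTranspose_self _
  have hQr : (G * PH * Gᴴ).rank = min N' (M - N) := by
    rw [← hQe, rank_self_mul_conjTranspose, hrank]
  obtain ⟨L, hL, hLt⟩ := aux_herm _ hQ _ _ hB0 hBt
  rw [hQr] at hLt
  set r := min N' (M - N) with hr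
  set A : ℝ → Matrix (Fin N') (Fin N') ℂ := fun ρ => 1 + (ρ : ℂ) • (G * Gᴴ) -
              ((ρ ^ 2 : ℝ) : ℂ) •
                (G * Hᴴ * (1 + (ρ : ℂ) • (H * Hᴴ))⁻¹ * (H * Gᴴ)) with hA
  have hAe : ∀ ρ : ℝ, 0 < ρ → (1 + G * ((((ρ⁻¹ : ℝ) : ℂ) • 1 + S)⁻¹ * (1 - PH)) * Gᴴ) +
      (ρ : ℂ) • (G * PH * Gᴴ) = A ρ := by
    intro ρ hρ
    have hT : IsUnit (((ρ⁻¹ : ℝ) : ℂ) • 1 + (Hᴴ * H + PH)).det := by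
      have hp : (((ρ⁻¹ : ℝ) : ℂ) • (1 : Matrix (Fin M) (Fin M) ℂ)).PosDef :=
        Matrix.PosDef.one.smul (by exact_mod_cast inv_pos.mpr hρ)
      exact (isUnit_iff_isUnit_det _).mp (hp.add_posSemidef hSps).isUnit
    have hid := congrArg (fun X => G * X * Gᴴ) (aux_identity H PH hPherm hPproj hHP hρ hT)
    simp only [mul_sub, mul_add, sub_mul, add_mul, mul_smul_comm, smul_mul_assoc, Matrix.mul_one,
      Matrix.mul_assoc, Matrix.mul_sub, Matrix.mul_add, Matrix.sub_mul, Matrix.add_mul,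
      Matrix.mul_smul, Matrix.smul_mul] at hid
    simp only [hA, hS, mul_sub, mul_add, sub_mul, add_mul, mul_smul_comm, smul_mul_assoc, Matrix.mul_one,
      Matrix.mul_assoc, Matrix.mul_sub, Matrix.mul_add, Matrix.sub_mul, Matrix.add_mul,
      Matrix.mul_smul, Matrix.smul_mul]
    rw [add_sub_assoc, hid]
    abel
  have hAh : ∀ ρ : ℝ, (A ρ).IsHermitian := by
    intro ρ
    simp [hA, Matrix.IsHermitian, conjTranspose_nonsing_inv, Matrix.mul_assoc]
  have hre : ∀ ρ : ℝ, (A ρ).det = (((A ρ).det.re : ℝ) : ℂ) := by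
    intro ρ
    have h1 : star (A ρ).det = (A ρ).det := by
      rw [← det_conjTranspose, (hAh ρ).eq]
    exact (Complex.conj_eq_iff_re.mp h1).symm
  have hlim : Filter.Tendsto (fun ρ : ℝ => (((A ρ).det.re / ρ ^ r : ℝ) : ℂ)) Filter.atTop
      (nhds L) := by
    refine hLt.congr' ?_
    filter_upwards [Filter.eventually_gt_atTop 0] with ρ hρ
    rw [hAe ρ hρ, hre ρ]
    push_cast
    simp
  have hlimre : Filter.Tendsto (fun ρ : ℝ => (A ρ).det.re / ρ ^ r) Filter.atTop (nhds L.re) := by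
    have := (Complex.continuous_re.tendsto L).comp hlim
    simpa [Function.comp_def, -Complex.ofReal_div] using this
  have hLre : L.re ≠ 0 := by
    have h2 := (Complex.continuous_ofReal.tendsto L.re).comp hlimre
    have h3 : L = (L.re : ℂ) := tendsto_nhds_unique hlim h2
    intro h
    rw [h] at h3
    exact hL (by simpa using h3)
  have hlog := hlimre.log hLre
  have hfin := (hlog.div_atTop Real.tendsto_log_atTop).add_const (r : ℝ)
  rw [zero_add] at hfin
  refine hfin.congr' ?_
  filter_upwards [Filter.eventually_gt_atTop 1, hlimre.eventually_ne hLre] with ρ hρ hne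
  have hlp : Real.log ρ ≠ 0 := (Real.log_pos hρ).ne'
  have hpow : ρ ^ r ≠ 0 := pow_ne_zero _ (by linarith)
  have hd : (A ρ).det.re ≠ 0 := fun h => hne (by rw [h, zero_div])
  rw [Real.log_div hd hpow, Real.log_pow]
  field_simp
  ring
end

section
/- Let H₁₁, H₁₂, H₂₁, H₂₂ be invertible M×M complex matrices such that the 2M×2M block matrix [[H₁₁, H₂₁],[H₁₂, H₂₂]] is also invertible, and let α ≥ 0 be a real number. For ρ > 0 let U(ρ) be the 2M×M matrix obtained by stacking √ρ·H₁₁ on top of √(ρ^α)·H₁₂, and let V(ρ) be the 2M×M matrix obtained by stacking √(ρ^α)·H₂₁ on top of √ρ·H₂₂. Then lim_{ρ→∞} [ log det( I_{2M} + U(ρ)U(ρ)† + V(ρ)V(ρ)† ) ] / log ρ = 2M · max{1, α}. -/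
open Matrix

open Filter Topology

lemma aux_rows {M : ℕ} (A B C D : Matrix (Fin M) (Fin M) ℂ) :
    fromRows A C * (fromRows A C)ᴴ + fromRows B D * (fromRows B D)ᴴ
      = fromBlocks A B C D * (fromBlocks A B C D)ᴴ := by
  rw [conjTranspose_fromRows_eq_fromCols_conjTranspose,
    conjTranspose_fromRows_eq_fromCols_conjTranspose, fromRows_mul_fromCols,
    fromRows_mul_fromCols, fromBlocks_conjTranspose, fromBlocks_multiply, fromBlocks_add]

/-- Limit of the normalised determinant. -/
lemma aux_lim_s14 {M : ℕ} (A B C D : Matrix (Fin M) (Fin M) ℂ) (s t e : ℝ → ℝ) (s0 t0 : ℝ)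
    (hs : Tendsto s atTop (𝓝 s0)) (ht : Tendsto t atTop (𝓝 t0)) (he : Tendsto e atTop (𝓝 0))
    (hdet : (fromBlocks ((s0 : ℂ) • A) ((t0 : ℂ) • B) ((t0 : ℂ) • C) ((s0 : ℂ) • D)).det ≠ 0) :
    ∃ c : ℝ, c ≠ 0 ∧ Tendsto (fun ρ => ((e ρ : ℂ) • (1 : Matrix (Fin M ⊕ Fin M) (Fin M ⊕ Fin M) ℂ) +
      fromBlocks ((s ρ : ℂ) • A) ((t ρ : ℂ) • B) ((t ρ : ℂ) • C) ((s ρ : ℂ) • D) *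
      (fromBlocks ((s ρ : ℂ) • A) ((t ρ : ℂ) • B) ((t ρ : ℂ) • C) ((s ρ : ℂ) • D))ᴴ).det.re)
      atTop (𝓝 c) := by
  let W : ℝ × ℝ → Matrix (Fin M ⊕ Fin M) (Fin M ⊕ Fin M) ℂ := fun p =>
    fromBlocks ((p.1 : ℂ) • A) ((p.2 : ℂ) • B) ((p.2 : ℂ) • C) ((p.1 : ℂ) • D)
  have hW : Continuous W := by
    apply Continuous.matrix_fromBlocks <;> fun_prop
  let G : ℝ × (ℝ × ℝ) → ℝ := fun q => ((q.1 : ℂ) • (1 : Matrix (Fin M ⊕ Fin M) (Fin M ⊕ Fin M) ℂ)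
    + W q.2 * (W q.2)ᴴ).det.re
  have hG : Continuous G := by
    have h2 : Continuous fun q : ℝ × (ℝ × ℝ) => W q.2 := hW.comp continuous_snd
    have h1 : Continuous fun q : ℝ × (ℝ × ℝ) =>
        (q.1 : ℂ) • (1 : Matrix (Fin M ⊕ Fin M) (Fin M ⊕ Fin M) ℂ) := by fun_prop
    exact Complex.continuous_re.comp
      (h1.add (h2.matrix_mul h2.matrix_conjTranspose)).matrix_det
  refine ⟨G (0, (s0, t0)), ?_, ?_⟩
  · have : G (0, (s0, t0)) = Complex.normSq (W (s0, t0)).det := by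
      simp only [G, Complex.ofReal_zero, zero_smul, zero_add, det_mul, det_conjTranspose]
      rw [Complex.star_def, Complex.mul_conj, Complex.ofReal_re]
    rw [this]
    exact fun h => hdet (Complex.normSq_eq_zero.mp h)
  · have h : Tendsto (fun ρ => (e ρ, (s ρ, t ρ))) atTop (𝓝 ((0 : ℝ), (s0, t0))) :=
      he.prodMk_nhds (hs.prodMk_nhds ht)
    have h3 := Tendsto.comp (hG.tendsto ((0 : ℝ), (s0, t0))) h
    exact h3

lemma aux_pow (γ : ℝ) (hγ : γ ≤ 0) :
    Tendsto (fun ρ : ℝ => Real.sqrt (ρ ^ γ)) atTop (𝓝 (if γ = 0 then 1 else 0)) := by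
  split_ifs with h
  · subst h; simp
  · have h1 : Tendsto (fun ρ : ℝ => ρ ^ γ) atTop (𝓝 0) := by
      have := tendsto_rpow_neg_atTop (y := -γ) (by
        have := lt_of_le_of_ne hγ h
        linarith)
      simpa using this
    simpa [Function.comp_def] using (Real.continuous_sqrt.tendsto 0).comp h1

lemma aux_final {M : ℕ} (A B C D : Matrix (Fin M) (Fin M) ℂ) (α β s0 t0 : ℝ) (hβ : 0 < β)
    (hs : Tendsto (fun ρ : ℝ => Real.sqrt (ρ ^ (1 - β))) atTop (𝓝 s0))
    (ht : Tendsto (fun ρ : ℝ => Real.sqrt (ρ ^ (α - β))) atTop (𝓝 t0))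
    (hdet : (fromBlocks ((s0 : ℂ) • A) ((t0 : ℂ) • B) ((t0 : ℂ) • C) ((s0 : ℂ) • D)).det ≠ 0) :
    Tendsto (fun ρ : ℝ => Real.log ((1 + 
      fromBlocks ((Real.sqrt ρ : ℂ) • A) ((Real.sqrt (ρ ^ α) : ℂ) • B)
        ((Real.sqrt (ρ ^ α) : ℂ) • C) ((Real.sqrt ρ : ℂ) • D) *
      (fromBlocks ((Real.sqrt ρ : ℂ) • A) ((Real.sqrt (ρ ^ α) : ℂ) • B)
        ((Real.sqrt (ρ ^ α) : ℂ) • C) ((Real.sqrt ρ : ℂ) • D))ᴴ).det.re) / Real.log ρ)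
      atTop (𝓝 (2 * (M : ℝ) * β)) := by
  obtain ⟨c, hc, hlim⟩ := aux_lim_s14 A B C D _ _ (fun ρ => ρ ^ (-β)) s0 t0 hs ht
    (tendsto_rpow_neg_atTop hβ) hdet
  have hlog := hlim.log hc
  have h0 := (hlog.div_atTop Real.tendsto_log_atTop).const_add (2 * (M : ℝ) * β)
  rw [add_zero] at h0
  refine h0.congr' ?_
  filter_upwards [hlim.eventually_ne hc, eventually_gt_atTop (1 : ℝ)] with ρ hne hρ
  have hρ0 : 0 < ρ := by linarith
  have hL : Real.log ρ ≠ 0 := (Real.log_pos hρ).ne'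
  set m : ℝ := Real.sqrt (ρ ^ β) with hm
  have e1 : Real.sqrt ρ = m * Real.sqrt (ρ ^ (1 - β)) := by
    rw [hm, ← Real.sqrt_mul (by positivity), ← Real.rpow_add hρ0]; simp
  have e2 : Real.sqrt (ρ ^ α) = m * Real.sqrt (ρ ^ (α - β)) := by
    rw [hm, ← Real.sqrt_mul (by positivity), ← Real.rpow_add hρ0]; simp
  have e3 : ((ρ ^ β : ℝ) : ℂ) = (m : ℂ) * m := by
    rw [← Complex.ofReal_mul, hm, Real.mul_self_sqrt (by positivity)]
  have e4 : ((ρ ^ β : ℝ) : ℂ) * ((ρ ^ (-β) : ℝ) : ℂ) = 1 := by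
    rw [← Complex.ofReal_mul, ← Real.rpow_add hρ0]; simp
  rw [e1, e2]
  set s := Real.sqrt (ρ ^ (1 - β))
  set t := Real.sqrt (ρ ^ (α - β))
  set W := fromBlocks ((s : ℂ) • A) ((t : ℂ) • B) ((t : ℂ) • C) ((s : ℂ) • D) with hW
  have eW : fromBlocks (((m * s : ℝ) : ℂ) • A) (((m * t : ℝ) : ℂ) • B)
      (((m * t : ℝ) : ℂ) • C) (((m * s : ℝ) : ℂ) • D) = (m : ℂ) • W := by
    rw [hW, fromBlocks_smul]; simp only [smul_smul, Complex.ofReal_mul]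
  have key : (1 : Matrix (Fin M ⊕ Fin M) (Fin M ⊕ Fin M) ℂ) + ((m : ℂ) • W) * ((m : ℂ) • W)ᴴ
      = ((ρ ^ β : ℝ) : ℂ) • (((ρ ^ (-β) : ℝ) : ℂ) • 1 + W * Wᴴ) := by
    rw [smul_add, smul_smul, e4, one_smul, e3, conjTranspose_smul, smul_mul_smul_comm]
    simp
  rw [eW, key, det_smul, ← Complex.ofReal_pow, Complex.re_ofReal_mul,
    Real.log_mul (by positivity) hne, Real.log_pow, Real.log_rpow hρ0]
  simp only [Fintype.card_sum, Fintype.card_fin]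
  push_cast
  field_simp
  ring

/-- For invertible `M × M` complex matrices `H₁₁, H₁₂, H₂₁, H₂₂`
such that the `2M × 2M` block matrix `[[H₁₁, H₂₁], [H₁₂, H₂₂]]` is invertible,
with `U(ρ) = [√ρ·H₁₁; √(ρ^α)·H₁₂]` and `V(ρ) = [√(ρ^α)·H₂₁; √ρ·H₂₂]` (stacked
rows), one has
`lim_{ρ → ∞} log det(I_{2M} + U(ρ)U(ρ)ᴴ + V(ρ)V(ρ)ᴴ) / log ρ = 2M · max{1, α}`. -/
theorem log_det_stacked_div_log_tendsto
    {M : ℕ} (H₁₁ H₁₂ H₂₁ H₂₂ : Matrix (Fin M) (Fin M) ℂ)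
    (h₁₁ : IsUnit H₁₁.det) (h₁₂ : IsUnit H₁₂.det)
    (h₂₁ : IsUnit H₂₁.det) (h₂₂ : IsUnit H₂₂.det)
    (hblock : IsUnit (Matrix.fromBlocks H₁₁ H₂₁ H₁₂ H₂₂).det)
    (α : ℝ) (hα : 0 ≤ α) :
    Filter.Tendsto
      (fun ρ : ℝ =>
        Real.log
          ((1 +
              (Matrix.fromRows ((Real.sqrt ρ : ℂ) • H₁₁)
                  ((Real.sqrt (ρ ^ α) : ℂ) • H₁₂)) *
                (Matrix.fromRows ((Real.sqrt ρ : ℂ) • H₁₁)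
                  ((Real.sqrt (ρ ^ α) : ℂ) • H₁₂))ᴴ +
              (Matrix.fromRows ((Real.sqrt (ρ ^ α) : ℂ) • H₂₁)
                  ((Real.sqrt ρ : ℂ) • H₂₂)) *
                (Matrix.fromRows ((Real.sqrt (ρ ^ α) : ℂ) • H₂₁)
                  ((Real.sqrt ρ : ℂ) • H₂₂))ᴴ).det.re) /
          Real.log ρ)
      Filter.atTop (nhds (2 * (M : ℝ) * max 1 α)) := by
  have hrow := fun ρ : ℝ => aux_rows ((Real.sqrt ρ : ℂ) • H₁₁) ((Real.sqrt (ρ ^ α) : ℂ) • H₂₁)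
    ((Real.sqrt (ρ ^ α) : ℂ) • H₁₂) ((Real.sqrt ρ : ℂ) • H₂₂)
  simp only [add_assoc, hrow]
  refine aux_final H₁₁ H₂₁ H₁₂ H₂₂ α (max 1 α) _ _ (by positivity)
    (aux_pow _ (by simp)) (aux_pow _ (by simp)) ?_
  rcases lt_trichotomy α 1 with h | h | h
  · have h' : α - 1 ≠ 0 := by linarith
    simp only [max_eq_left h.le, sub_self, if_true, if_neg h']
    simp [det_fromBlocks_zero₂₁, h₁₁.ne_zero, h₂₂.ne_zero]
  · subst h
    simpa using hblock.ne_zero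
  · have h' : 1 - α ≠ 0 := by linarith
    simp only [max_eq_right h.le, sub_self, if_true, if_neg h']
    have hinv : fromBlocks 0 H₂₁ H₁₂ 0 * fromBlocks 0 H₁₂⁻¹ H₂₁⁻¹ 0 = 1 := by
      rw [fromBlocks_multiply]
      simp [mul_nonsing_inv _ h₁₂, mul_nonsing_inv _ h₂₁]
    simpa using (isUnit_det_of_right_inverse hinv).ne_zero
end

section
/- Let M > 0 and β be real numbers with 0 ≤ β ≤ M/2, and let α ≥ 0. Then GDoF(M,α,β) = min{E₁,…,E₆} equals: M, if 0 ≤ α ≤ β/M; M·(1−α) + β, if β/M ≤ α ≤ 1/2; M·α + β, if 1/2 ≤ α ≤ 2/3 − β/(3M); (M·(2−α) + β)/2, if 2/3 − β/(3M) ≤ α ≤ 1; (M·α + β)/2, if 1 ≤ α ≤ 2 + β/M; and M + β, if α ≥ 2 + β/M. -/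
/-- The six bounds `E₁, …, E₆` characterizing the symmetric GDoF of the two-user
MIMO interference channel with limited receiver cooperation, and their minimum. -/
noncomputable def GDoF (M α β : ℝ) : ℝ :=
  min (M + min (max (α - 1) 0 * M) β)                                   -- E₁
    (min (M * max (max (1 - α) 0) α + β)                                 -- E₂
      (min ((1 / 2) * max (1 - α) 0 * M + (1 / 2) * M * max 1 α + (1 / 2) * β)  -- E₃
        (min (M * max 1 α)                                               -- E₄
          (min ((1 / 3) * M * max (max (1 - α) 0) α + (1 / 3) * max (1 - α) 0 * M +
                (1 / 3) * M * max 1 α + (2 / 3) * β)                     -- E₅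
            ((1 / 3) * M * max (max (2 - α) 0) α + (1 / 3) * M * max 1 α +
              (1 / 3) * β)))))                                           -- E₆

/-- Piecewise form of the symmetric GDoF for weak cooperation
`0 ≤ β ≤ M/2`. -/
theorem gdof_piecewise_weak_coop (M β : ℝ) (hM : 0 < M) (hβ0 : 0 ≤ β)
    (hβ : β ≤ M / 2) (α : ℝ) (hα : 0 ≤ α) :
    (α ≤ β / M → GDoF M α β = M) ∧
    (β / M ≤ α → α ≤ 1 / 2 → GDoF M α β = M * (1 - α) + β) ∧
    (1 / 2 ≤ α → α ≤ 2 / 3 - β / (3 * M) → GDoF M α β = M * α + β) ∧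
    (2 / 3 - β / (3 * M) ≤ α → α ≤ 1 → GDoF M α β = (M * (2 - α) + β) / 2) ∧
    (1 ≤ α → α ≤ 2 + β / M → GDoF M α β = (M * α + β) / 2) ∧
    (2 + β / M ≤ α → GDoF M α β = M + β) := by
  have key : ∀ v e1 e2 e3 e4 e5 e6 : ℝ, v ≤ e1 → v ≤ e2 → v ≤ e3 → v ≤ e4 → v ≤ e5 → v ≤ e6 →
      (e1 ≤ v ∨ e2 ≤ v ∨ e3 ≤ v) →
      min e1 (min e2 (min e3 (min e4 (min e5 e6)))) = v := by
    intro v e1 e2 e3 e4 e5 e6 h1 h2 h3 h4 h5 h6 h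
    apply le_antisymm
    · simp only [min_le_iff]
      tauto
    · simp only [le_min_iff]
      tauto
  have hdiv : β / (3 * M) = β / M / 3 := by
    field_simp
  obtain ⟨b, rfl⟩ : ∃ b, β = b * M := ⟨β / M, by field_simp⟩
  have hb : b * M / M = b := by field_simp
  rw [hdiv, hb]
  have hb0 : 0 ≤ b := by
    by_contra h
    push Not at h
    nlinarith
  have hb2 : b ≤ 1 / 2 := by
    by_contra h
    push Not at h
    nlinarith
  unfold GDoF
  refine ⟨fun h1 => ?_, fun h1 h2 => ?_, fun h1 h2 => ?_, fun h1 h2 => ?_, fun h1 h2 => ?_,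
    fun h1 => ?_⟩
  · rw [max_eq_right (by linarith : α - 1 ≤ 0), max_eq_left (by linarith : 0 ≤ 1 - α),
      max_eq_left (by linarith : α ≤ 1 - α), max_eq_left (by linarith : α ≤ 1),
      max_eq_left (by linarith : 0 ≤ 2 - α), max_eq_left (by linarith : α ≤ 2 - α),
      zero_mul, min_eq_left hβ0]
    apply key <;> first | nlinarith | (left; linarith)
  · rw [max_eq_right (by linarith : α - 1 ≤ 0), max_eq_left (by linarith : 0 ≤ 1 - α),
      max_eq_left (by linarith : α ≤ 1 - α), max_eq_left (by linarith : α ≤ 1),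
      max_eq_left (by linarith : 0 ≤ 2 - α), max_eq_left (by linarith : α ≤ 2 - α),
      zero_mul, min_eq_left hβ0]
    apply key <;> first | nlinarith | (right; left; linarith)
  · rw [max_eq_right (by linarith : α - 1 ≤ 0), max_eq_left (by linarith : 0 ≤ 1 - α),
      max_eq_right (by linarith : 1 - α ≤ α), max_eq_left (by linarith : α ≤ 1),
      max_eq_left (by linarith : 0 ≤ 2 - α), max_eq_left (by linarith : α ≤ 2 - α),
      zero_mul, min_eq_left hβ0]
    apply key <;> first | nlinarith | (right; left; linarith)
  · rw [max_eq_right (by linarith : α - 1 ≤ 0), max_eq_left (by linarith : 0 ≤ 1 - α),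
      max_eq_right (by linarith : 1 - α ≤ α), max_eq_left (by linarith : α ≤ 1),
      max_eq_left (by linarith : 0 ≤ 2 - α), max_eq_left (by linarith : α ≤ 2 - α),
      zero_mul, min_eq_left hβ0]
    apply key <;> first | nlinarith | (right; right; linarith)
  · have hm : (M * α + b * M) / 2 - M ≤ min ((α - 1) * M) (b * M) :=
      le_min (by nlinarith) (by nlinarith)
    have hx : max (max (2 - α) 0) α = α :=
      max_eq_right (max_le (by linarith) hα)
    rw [max_eq_left (by linarith : 0 ≤ α - 1), max_eq_right (by linarith : 1 - α ≤ 0),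
      max_eq_right hα, max_eq_right h1, hx]
    apply key <;> first | nlinarith | (right; right; linarith)
  · have hx : max (max (2 - α) 0) α = α :=
      max_eq_right (max_le (by linarith) hα)
    rw [max_eq_left (by linarith : 0 ≤ α - 1), max_eq_right (by linarith : 1 - α ≤ 0),
      max_eq_right hα, max_eq_right (by linarith : 1 ≤ α), hx,
      min_eq_right (by nlinarith : b * M ≤ (α - 1) * M)]
    apply key <;> first | nlinarith | (left; linarith)
end

section
/- Let M > 0 and β be real numbers with M/2 ≤ β ≤ M, and let α ≥ 0. Then GDoF(M,α,β) = min{E₁,…,E₆} equals: M, if 0 ≤ α ≤ β/M; (M·(2−α) + β)/2, if β/M ≤ α ≤ 1; (M·α + β)/2, if 1 ≤ α ≤ 2 + β/M; and M + β, if α ≥ 2 + β/M. -/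
/-- The bounds rewritten in terms of `a = M * α`, which makes everything piecewise linear. -/
theorem GDoF_linear (M α β : ℝ) (hM : 0 < M) :
    GDoF M α β =
      min (M + min (max (M * α - M) 0) β)
        (min (max (max (M - M * α) 0) (M * α) + β)
          (min ((1 / 2) * max (M - M * α) 0 + (1 / 2) * max M (M * α) + (1 / 2) * β)
            (min (max M (M * α))
              (min ((1 / 3) * max (max (M - M * α) 0) (M * α) + (1 / 3) * max (M - M * α) 0 +
                    (1 / 3) * max M (M * α) + (2 / 3) * β)
                ((1 / 3) * max (max (2 * M - M * α) 0) (M * α) + (1 / 3) * max M (M * α) +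
                  (1 / 3) * β))))) := by
  have h (x y : ℝ) : M * max x y = max (M * x) (M * y) := mul_max_of_nonneg x y hM.le
  have e1 : max (α - 1) 0 * M = max (M * α - M) 0 := by
    rw [mul_comm, h]; congr 1 <;> ring
  have e2 : max (1 - α) 0 * M = max (M - M * α) 0 := by
    rw [mul_comm, h]; congr 1 <;> ring
  have e3 : M * max (max (1 - α) 0) α = max (max (M - M * α) 0) (M * α) := by
    rw [h, mul_comm, e2]
  have e4 : M * max 1 α = max M (M * α) := by rw [h, mul_one]
  have e5 : M * max (max (2 - α) 0) α = max (max (2 * M - M * α) 0) (M * α) := by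
    rw [h, h, mul_zero, mul_sub, mul_comm M 2]
  unfold GDoF
  simp only [mul_assoc, e1, e2, e3, e4, e5]

/-- Piecewise form of the symmetric GDoF for moderate
cooperation `M/2 ≤ β ≤ M`. -/
theorem gdof_piecewise_moderate_coop (M β : ℝ) (hM : 0 < M) (hβl : M / 2 ≤ β)
    (hβu : β ≤ M) (α : ℝ) (hα : 0 ≤ α) :
    (α ≤ β / M → GDoF M α β = M) ∧
    (β / M ≤ α → α ≤ 1 → GDoF M α β = (M * (2 - α) + β) / 2) ∧
    (1 ≤ α → α ≤ 2 + β / M → GDoF M α β = (M * α + β) / 2) ∧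
    (2 + β / M ≤ α → GDoF M α β = M + β) := by
  rw [GDoF_linear M α β hM]
  have ha : 0 ≤ M * α := mul_nonneg hM.le hα
  have h1 : α ≤ β / M ↔ M * α ≤ β := by rw [le_div_iff₀ hM, mul_comm]
  have h2 : β / M ≤ α ↔ β ≤ M * α := by rw [div_le_iff₀ hM, mul_comm]
  have h3 : α ≤ 1 ↔ M * α ≤ M := by
    constructor <;> intro h <;> nlinarith
  have h4 : 1 ≤ α ↔ M ≤ M * α := by
    constructor <;> intro h <;> nlinarith
  have h5 : α ≤ 2 + β / M ↔ M * α ≤ 2 * M + β := by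
    rw [← sub_le_iff_le_add', le_div_iff₀ hM]
    constructor <;> intro h <;> linarith
  have h6 : 2 + β / M ≤ α ↔ 2 * M + β ≤ M * α := by
    rw [← le_sub_iff_add_le', div_le_iff₀ hM]
    constructor <;> intro h <;> linarith
  rw [h1, h2, h3, h4, h5, h6, mul_sub]
  clear h1 h2 h3 h4 h5 h6
  generalize M * α = a at *
  refine ⟨fun h => ?_, fun h h' => ?_, fun h h' => ?_, fun h => ?_⟩ <;> grind
end

section
/- Let M > 0 and β be real numbers with β ≥ M, and let α ≥ 0. Then GDoF(M,α,β) = min{E₁,…,E₆} equals: M, if 0 ≤ α ≤ 1; M·α, if 1 ≤ α ≤ β/M; (M·α + β)/2, if β/M ≤ α ≤ 2 + β/M; and M + β, if α ≥ 2 + β/M. -/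
/-- Piecewise form of the symmetric GDoF for strong
cooperation `β ≥ M`. -/
theorem gdof_piecewise_strong_coop (M β : ℝ) (hM : 0 < M) (hβ : M ≤ β)
    (α : ℝ) (hα : 0 ≤ α) :
    (α ≤ 1 → GDoF M α β = M) ∧
    (1 ≤ α → α ≤ β / M → GDoF M α β = M * α) ∧
    (β / M ≤ α → α ≤ 2 + β / M → GDoF M α β = (M * α + β) / 2) ∧
    (2 + β / M ≤ α → GDoF M α β = M + β) := by
  have hdiv1 : α ≤ β / M → M * α ≤ β := fun h => by
    rw [le_div_iff₀ hM] at h; linarith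
  have hdiv2 : β / M ≤ α → β ≤ M * α := fun h => by
    rw [div_le_iff₀ hM] at h; linarith
  have hMα : 0 ≤ M * α := by positivity
  -- closed form of the minimum for `1 ≤ α`
  have key : 1 ≤ α → GDoF M α β =
      min (M + min ((α - 1) * M) β) (min (M * α + β)
        (min ((1 / 2) * M * α + (1 / 2) * β) (min (M * α)
          (min ((2 / 3) * (M * α) + (2 / 3) * β)
            ((2 / 3) * (M * α) + (1 / 3) * β))))) := by
    intro h
    have e1 : max (α - 1) 0 = α - 1 := max_eq_left (by linarith)
    have e2 : max (1 - α) 0 = 0 := max_eq_right (by linarith)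
    have e3 : max 1 α = α := max_eq_right h
    have e4 : max (max (2 - α) 0) α = α :=
      max_eq_right (max_le (by linarith) hα)
    unfold GDoF
    rw [e1, e2, e3, e4, max_eq_right hα]
    ring_nf
  have one_le : β / M ≤ α → 1 ≤ α := fun h =>
    le_trans ((one_le_div hM).2 hβ) h
  refine ⟨fun h => ?_, fun h1 h2 => ?_, fun h1 h2 => ?_, fun h => ?_⟩
  · have e1 : max (α - 1) 0 = 0 := max_eq_right (by linarith)
    have e2 : max (1 - α) 0 = 1 - α := max_eq_left (by linarith)
    have e3 : max 1 α = 1 := max_eq_left h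
    have e4 : max (max (2 - α) 0) α = 2 - α := by
      rw [max_eq_left (by linarith : (0 : ℝ) ≤ 2 - α), max_eq_left (by linarith)]
    have hle : M * α ≤ M := by nlinarith
    have h5 : M * α ≤ M * max (1 - α) α :=
      mul_le_mul_of_nonneg_left (le_max_right _ _) hM.le
    unfold GDoF
    rw [e1, e2, e3, e4, zero_mul, min_eq_left (by linarith : (0 : ℝ) ≤ β), add_zero]
    refine min_eq_left ?_
    simp only [le_min_iff]
    refine ⟨?_, ?_, ?_, ?_, ?_⟩ <;> nlinarith
  · have := hdiv1 h2
    rw [key h1]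
    apply le_antisymm
    · simp only [min_le_iff]; right; right; right; left; exact le_rfl
    · simp only [le_min_iff, ← min_add_add_left]
      refine ⟨⟨?_, ?_⟩, ?_, ?_, ?_, ?_, ?_⟩ <;> nlinarith
  · have := hdiv2 h1
    have h3 : M * α ≤ 2 * M + β := by
      have : α - 2 ≤ β / M := by linarith
      rw [le_div_iff₀ hM] at this; linarith
    rw [key (one_le h1)]
    apply le_antisymm
    · simp only [min_le_iff]; right; right; left; linarith
    · simp only [le_min_iff, ← min_add_add_left]
      refine ⟨⟨?_, ?_⟩, ?_, ?_, ?_, ?_, ?_⟩ <;> nlinarith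
  · have h3 : 2 * M + β ≤ M * α := by
      have : β / M ≤ α - 2 := by linarith
      rw [div_le_iff₀ hM] at this; linarith
    rw [key (one_le (by linarith))]
    apply le_antisymm
    · simp only [min_le_iff, ← min_add_add_left]; left; right; exact le_rfl
    · simp only [le_min_iff, ← min_add_add_left]
      refine ⟨⟨?_, ?_⟩, ?_, ?_, ?_, ?_, ?_⟩ <;> nlinarith
end

section
/- Let M and N be positive integers with M ≤ N and let β ≥ 0 be a real number. Define D ⊆ ℝ² as the set of pairs (d₁,d₂) with d₁ ≥ 0, d₂ ≥ 0 satisfying all of the following inequalities (the symmetric specialization M₁=M₂=M, N₁=N₂=N, β₁₂=β₂₁=β of the DoF-region bounds): d₁ ≤ min{M,N} + min{ min{N,(M−N)⁺}, β }; d₂ ≤ min{M,N} + min{ min{N,(M−N)⁺}, β }; d₁+d₂ ≤ 2·min{N,(M−N)⁺+M} + 2β; d₁+d₂ ≤ min{N,(M−N)⁺} + min{N,2M} + β; d₁+d₂ ≤ min{2N,2M}; 2d₁+d₂ ≤ min{N,(M−N)⁺+M} + min{N,(M−N)⁺} + min{N,2M} + 2β; d₁+2d₂ ≤ min{N,(M−N)⁺+M}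 + min{N,(M−N)⁺} + min{N,2M} + 2β; 2d₁+d₂ ≤ min{2N,M} + min{N,2M} + β; d₁+2d₂ ≤ min{2N,M} + min{N,2M} + β. Then D equals the pentagon {(d₁,d₂) ∈ ℝ² : 0 ≤ d₁ ≤ M, 0 ≤ d₂ ≤ M, d₁+d₂ ≤ N+β}. -/
/-- For positive integers `M ≤ N` and real `β ≥ 0`, the
symmetric DoF region (the specialization `M₁ = M₂ = M`, `N₁ = N₂ = N`,
`β₁₂ = β₂₁ = β` of the general DoF-region bounds) equals the pentagon
`{(d₁, d₂) : 0 ≤ d₁ ≤ M, 0 ≤ d₂ ≤ M, d₁ + d₂ ≤ N + β}`. -/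
theorem dof_region_M_le_N (M N : ℕ) (hM : 0 < M) (hN : 0 < N) (hMN : M ≤ N)
    (β : ℝ) (hβ : 0 ≤ β) :
    {p : ℝ × ℝ | 0 ≤ p.1 ∧ 0 ≤ p.2 ∧
      p.1 ≤ min (M : ℝ) N + min (min (N : ℝ) (max ((M : ℝ) - N) 0)) β ∧
      p.2 ≤ min (M : ℝ) N + min (min (N : ℝ) (max ((M : ℝ) - N) 0)) β ∧
      p.1 + p.2 ≤ 2 * min (N : ℝ) (max ((M : ℝ) - N) 0 + M) + 2 * β ∧
      p.1 + p.2 ≤ min (N : ℝ) (max ((M : ℝ) - N) 0) + min (N : ℝ) (2 * M) + β ∧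
      p.1 + p.2 ≤ min (2 * (N : ℝ)) (2 * M) ∧
      2 * p.1 + p.2 ≤ min (N : ℝ) (max ((M : ℝ) - N) 0 + M) +
        min (N : ℝ) (max ((M : ℝ) - N) 0) + min (N : ℝ) (2 * M) + 2 * β ∧
      p.1 + 2 * p.2 ≤ min (N : ℝ) (max ((M : ℝ) - N) 0 + M) +
        min (N : ℝ) (max ((M : ℝ) - N) 0) + min (N : ℝ) (2 * M) + 2 * β ∧
      2 * p.1 + p.2 ≤ min (2 * (N : ℝ)) (M : ℝ) + min (N : ℝ) (2 * M) + β ∧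
      p.1 + 2 * p.2 ≤ min (2 * (N : ℝ)) (M : ℝ) + min (N : ℝ) (2 * M) + β} =
    {p : ℝ × ℝ | 0 ≤ p.1 ∧ p.1 ≤ M ∧ 0 ≤ p.2 ∧ p.2 ≤ M ∧ p.1 + p.2 ≤ N + β} := by
  have h : (M : ℝ) ≤ N := by exact_mod_cast hMN
  have hM0 : (0 : ℝ) ≤ M := Nat.cast_nonneg M
  have hN0 : (0 : ℝ) ≤ N := Nat.cast_nonneg N
  have e1 : max ((M : ℝ) - N) 0 = 0 := max_eq_right (by linarith)
  have e2 : min (2 * (N : ℝ)) (2 * M) = 2 * M := min_eq_right (by linarith)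
  have e3 : min (2 * (N : ℝ)) (M : ℝ) = M := min_eq_right (by linarith)
  ext ⟨x, y⟩
  simp only [Set.mem_setOf_eq, e1, e2, e3, min_eq_left h, min_eq_right hN0, min_eq_left hβ,
    zero_add, add_zero, min_eq_right h]
  constructor
  · rintro ⟨h1, h2, h3, h4, -, h6, -⟩
    have := min_le_left (N : ℝ) (2 * M)
    exact ⟨h1, h3, h2, h4, by linarith⟩
  · rintro ⟨h1, h2, h3, h4, h5⟩
    rcases min_cases (N : ℝ) (2 * M) with ⟨e, _⟩ | ⟨e, _⟩ <;> rw [e] <;>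
      refine ⟨?_, ?_, ?_, ?_, ?_, ?_, ?_, ?_, ?_, ?_, ?_⟩ <;> linarith
end
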